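/- Let F be (λ,Λ)-elliptic, κ ≥ 0, q ≥ 0, ξ ∈ ℝⁿ, ϑ > 0, and let u : B₁ → ℝ with ‖u‖_{L^∞(B₁)} ≤ 1 and f with ‖f‖_{L^∞(B₁)} ≤ 1 be such that v(x) := ξ·x + ϑu(x) is a κ-grad viscosity solution in B₁ of (|Dv|−κ)₊^q F_ϑ(D²v) = ϑf, where F_ϑ(M) := ϑF(ϑ^{−1}M). Then for every μ ∈ (0,1) there exists a constant C > 0, depending only on n, λ and Λ, such that: if |ξ| ≥ κ + 2μ and ϑ ≤ μ^{q+1}/(2C), then |u(x) − u(y)| ≤ Cμ^{−q}|x−y| for all x, y ∈ B_{1/2}. -/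

import Mathlib

open Metric Set Matrix MeasureTheory
open scoped RealInnerProductSpace

noncomputable section

abbrev Euc (n : ℕ) := EuclideanSpace ℝ (Fin n)

def EllMat (n : ℕ) (lam Lam : ℝ) : Set (Matrix (Fin n) (Fin n) ℝ) :=
  {A | A.IsSymm ∧ ∀ ξ : Fin n → ℝ,
      lam * (ξ ⬝ᵥ ξ) ≤ ξ ⬝ᵥ A.mulVec ξ ∧ ξ ⬝ᵥ A.mulVec ξ ≤ Lam * (ξ ⬝ᵥ ξ)}

/-- Pucci maximal operator `M⁺`. -/
def pucciSup (n : ℕ) (lam Lam : ℝ) (M : Matrix (Fin n) (Fin n) ℝ) : ℝ :=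
  sSup ((fun A => (A * M).trace) '' EllMat n lam Lam)

/-- Pucci minimal operator `M⁻`. -/
def pucciInf (n : ℕ) (lam Lam : ℝ) (M : Matrix (Fin n) (Fin n) ℝ) : ℝ :=
  sInf ((fun A => (A * M).trace) '' EllMat n lam Lam)

/-- `(λ,Λ)`-ellipticity of `F`. -/
def IsUniformlyElliptic (n : ℕ) (lam Lam : ℝ)
    (F : Matrix (Fin n) (Fin n) ℝ → ℝ) : Prop :=
  ∀ M N : Matrix (Fin n) (Fin n) ℝ, M.IsSymm → N.IsSymm →
    pucciInf n lam Lam (M - N) ≤ F M - F N ∧ F M - F N ≤ pucciSup n lam Lam (M - N)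

/-- Hessian matrix of `φ` at `x`. -/
def hess {n : ℕ} (φ : Euc n → ℝ) (x : Euc n) : Matrix (Fin n) (Fin n) ℝ :=
  fun i j => iteratedFDeriv ℝ 2 φ x ![EuclideanSpace.single i 1, EuclideanSpace.single j 1]

/-- `κ`-grad viscosity subsolution of `G(Du, D²u) = f` in `s`. -/
def GradSubSol {n : ℕ} (κ : ℝ) (G : Euc n → Matrix (Fin n) (Fin n) ℝ → ℝ)
    (f : Euc n → ℝ) (s : Set (Euc n)) (u : Euc n → ℝ) : Prop :=
  ∀ x₀ ∈ s, ∀ φ : Euc n → ℝ, ContDiff ℝ 2 φ →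
    IsLocalMax (fun x => u x - φ x) x₀ → κ < ‖gradient φ x₀‖ →
    f x₀ ≤ G (gradient φ x₀) (hess φ x₀)

/-- `κ`-grad viscosity supersolution of `G(Du, D²u) = f` in `s`. -/
def GradSupSol {n : ℕ} (κ : ℝ) (G : Euc n → Matrix (Fin n) (Fin n) ℝ → ℝ)
    (f : Euc n → ℝ) (s : Set (Euc n)) (u : Euc n → ℝ) : Prop :=
  ∀ x₀ ∈ s, ∀ φ : Euc n → ℝ, ContDiff ℝ 2 φ →
    IsLocalMin (fun x => u x - φ x) x₀ → κ < ‖gradient φ x₀‖ →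
    G (gradient φ x₀) (hess φ x₀) ≤ f x₀

/-- `κ`-grad viscosity solution. -/
def GradSol {n : ℕ} (κ : ℝ) (G : Euc n → Matrix (Fin n) (Fin n) ℝ → ℝ)
    (f : Euc n → ℝ) (s : Set (Euc n)) (u : Euc n → ℝ) : Prop :=
  GradSubSol κ G f s u ∧ GradSupSol κ G f s u

/-- Classical viscosity solution (no restriction on the slope of test functions). -/
def ViscSol {n : ℕ} (G : Euc n → Matrix (Fin n) (Fin n) ℝ → ℝ)
    (f : Euc n → ℝ) (s : Set (Euc n)) (u : Euc n → ℝ) : Prop :=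
  (∀ x₀ ∈ s, ∀ φ : Euc n → ℝ, ContDiff ℝ 2 φ →
    IsLocalMax (fun x => u x - φ x) x₀ → f x₀ ≤ G (gradient φ x₀) (hess φ x₀)) ∧
  (∀ x₀ ∈ s, ∀ φ : Euc n → ℝ, ContDiff ℝ 2 φ →
    IsLocalMin (fun x => u x - φ x) x₀ → G (gradient φ x₀) (hess φ x₀) ≤ f x₀)

/-- The operator `G(ξ, M) = (|ξ|-κ)₊^q F(M)`. -/
def mainG {n : ℕ} (κ q : ℝ) (F : Matrix (Fin n) (Fin n) ℝ → ℝ) :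
    Euc n → Matrix (Fin n) (Fin n) ℝ → ℝ :=
  fun ξ M => max (‖ξ‖ - κ) 0 ^ q * F M

/-- The set `Ω_u` of points of `s` that can be touched from above or below by a `C²`
function with slope larger than `κ`. -/
def omegaSet {n : ℕ} (κ : ℝ) (s : Set (Euc n)) (u : Euc n → ℝ) : Set (Euc n) :=
  {x ∈ s | ∃ φ : Euc n → ℝ, ContDiff ℝ 2 φ ∧
    (IsLocalMax (fun y => u y - φ y) x ∨ IsLocalMin (fun y => u y - φ y) x) ∧
    κ < ‖gradient φ x‖}

/-- Effective viscosity solution of `(|Du|-κ)₊^q F(D²u) = f` in `s`. -/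
def EffectiveSol {n : ℕ} (κ q : ℝ) (F : Matrix (Fin n) (Fin n) ℝ → ℝ)
    (f : Euc n → ℝ) (s : Set (Euc n)) (u : Euc n → ℝ) : Prop :=
  IsOpen (omegaSet κ s u) ∧ ViscSol (mainG κ q F) f (omegaSet κ s u) u

open Filter Topology
open scoped NNReal

section Regularization

variable {E : Type*} [NormedAddCommGroup E] [InnerProductSpace ℝ E]

/-- A vector whose pairing with every `h` is `O(‖h‖²)` vanishes. -/
lemma eq_zero_of_forall_inner_le {v : E} {C : ℝ} (h : ∀ x, ⟪v, x⟫ ≤ C * ‖x‖ ^ 2) : v = 0 := by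
  by_contra hv
  have hv' : 0 < ‖v‖ ^ 2 := by positivity
  have hC : 0 < |C| + 1 := by positivity
  have h1 := h ((1 / (|C| + 1)) • v)
  rw [inner_smul_right, real_inner_self_eq_norm_sq, norm_smul, Real.norm_of_nonneg (by positivity),
    mul_pow] at h1
  have h2 : 1 / (|C| + 1) * ‖v‖ ^ 2 * (|C| + 1) ^ 2
      ≤ C * ((1 / (|C| + 1)) ^ 2 * ‖v‖ ^ 2) * (|C| + 1) ^ 2 := by gcongr
  field_simp at h2
  nlinarith [le_abs_self C]

/-- A function with two-sided quadratic tangent bounds has Lipschitz slope. -/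
lemma lipschitzWith_of_quadratic_bound {φ : E → ℝ} {p : E → E} {c : ℝ}
    (h : ∀ y k, |φ (y + k) - φ y - ⟪p y, k⟫| ≤ c * ‖k‖ ^ 2) :
    LipschitzWith (6 * c).toNNReal p := by
  refine LipschitzWith.of_dist_le' fun y y' => ?_
  rcases eq_or_ne y y' with rfl | hyy
  · simp
  rcases eq_or_ne (p y) (p y') with hp | hp
  · have hc : 0 ≤ c * ‖y - y'‖ ^ 2 := (abs_nonneg _).trans (h y _)
    have : 0 < ‖y - y'‖ := norm_pos_iff.2 (sub_ne_zero.2 hyy)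
    have hc' : 0 ≤ c := nonneg_of_mul_nonneg_left hc (by positivity)
    rw [hp, dist_self]; positivity
  rw [dist_eq_norm, dist_eq_norm]
  set d := ‖y - y'‖ with hd
  have hd0 : 0 < d := norm_pos_iff.2 (sub_ne_zero.2 hyy)
  have hs0 : 0 < ‖p y - p y'‖ := norm_pos_iff.2 (sub_ne_zero.2 hp)
  set s := ‖p y - p y'‖ with hs
  set k : E := (-(d / s)) • (p y - p y') with hk
  have hkn : ‖k‖ = d := by
    rw [hk, norm_smul, norm_neg, Real.norm_of_nonneg (by positivity), ← hs]; field_simp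
  have hpk : ⟪p y' - p y, k⟫ = d * s := by
    rw [hk, ← neg_sub (p y) (p y'), inner_neg_left, inner_smul_right, real_inner_self_eq_norm_sq,
      ← hs]
    field_simp
  have h1 := (abs_le.1 (h y (y' + k - y))).2
  have h2 := (abs_le.1 (h y' k)).1
  have h3 := (abs_le.1 (h y (y' - y))).1
  rw [add_sub_cancel] at h1 h3
  have hn : ‖y' - y‖ = d := by rw [norm_sub_rev]
  have hn2 : ‖y' + k - y‖ ^ 2 ≤ 4 * d ^ 2 := by
    have : ‖y' + k - y‖ ≤ 2 * d := by
      calc ‖y' + k - y‖ = ‖(y' - y) + k‖ := by congr 1; abel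
        _ ≤ ‖y' - y‖ + ‖k‖ := norm_add_le _ _
        _ = 2 * d := by rw [hn, hkn]; ring
    nlinarith [norm_nonneg (y' + k - y)]
  have hc' : 0 ≤ c := nonneg_of_mul_nonneg_left ((abs_nonneg _).trans (h y (y - y')))
    (by positivity)
  rw [hkn] at h2
  rw [hn] at h3
  have e1 : ⟪p y, y' + k - y⟫ = ⟪p y, y' - y⟫ + ⟪p y, k⟫ := by
    rw [← inner_add_right]; congr 1; abel
  rw [inner_sub_left] at hpk
  have h4 : c * ‖y' + k - y‖ ^ 2 ≤ c * (4 * d ^ 2) := by gcongr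
  have h5 : d * s ≤ d * (6 * c * d) := by nlinarith
  exact le_of_mul_le_mul_left h5 hd0

/-- Existence of the sup-convolution over a compact set. -/
lemma exists_supConvolution {K : Set E} (hK : IsCompact K) (hKne : K.Nonempty) {g : E → ℝ}
    (hg : ContinuousOn g K) {t : ℝ} (ht : 0 < t) :
    ∃ s : E → ℝ, Continuous s ∧ (∀ x, ∃ z ∈ K, s x = g z - ‖x - z‖ ^ 2 / (4 * t)) ∧
      ∀ x, ∀ z ∈ K, g z - ‖x - z‖ ^ 2 / (4 * t) ≤ s x := by
  have hex : ∀ x : E, ∃ z ∈ K, ∀ z' ∈ K,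
      g z' - ‖x - z'‖ ^ 2 / (4 * t) ≤ g z - ‖x - z‖ ^ 2 / (4 * t) := fun x => by
    obtain ⟨z, hz, hz'⟩ := hK.exists_isMaxOn hKne
      (hg.sub (f := g) (g := fun z => ‖x - z‖ ^ 2 / (4 * t)) (by fun_prop))
    exact ⟨z, hz, fun z' h => hz' h⟩
  choose Z hZK hZ using hex
  obtain ⟨R, hR⟩ := hK.isBounded.exists_norm_le
  refine ⟨fun x => g (Z x) - ‖x - Z x‖ ^ 2 / (4 * t), ?_, fun x => ⟨Z x, hZK x, rfl⟩,
    fun x z hz => hZ x z hz⟩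
  have hlip : LipschitzWith (R / (2 * t)).toNNReal
      (fun x => g (Z x) - ‖x - Z x‖ ^ 2 / (4 * t) + ‖x‖ ^ 2 / (4 * t)) := by
    refine LipschitzWith.of_le_add_mul' _ fun x y => ?_
    have h1 := hZ y (Z x) (hZK x)
    have h2 : ⟪x - y, Z x⟫ ≤ R * dist x y := by
      rw [dist_eq_norm]
      calc ⟪x - y, Z x⟫ ≤ ‖x - y‖ * ‖Z x‖ := real_inner_le_norm _ _
        _ ≤ ‖x - y‖ * R := by gcongr; exact hR _ (hZK x)
        _ = _ := mul_comm _ _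
    rw [inner_sub_left] at h2
    have e1 := norm_sub_sq_real x (Z x)
    have e2 := norm_sub_sq_real y (Z x)
    have h3 : R / (2 * t) * dist x y = (R * dist x y) * 2 / (4 * t) := by field_simp; ring
    rw [h3]
    have h4 : (‖x‖ ^ 2 - ‖x - Z x‖ ^ 2 - (‖y‖ ^ 2 - ‖y - Z x‖ ^ 2)) / (4 * t)
        ≤ (R * dist x y) * 2 / (4 * t) := by
      gcongr; linarith
    have e3 : (‖x‖ ^ 2 - ‖x - Z x‖ ^ 2 - (‖y‖ ^ 2 - ‖y - Z x‖ ^ 2)) / (4 * t) =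
      ‖x‖ ^ 2 / (4 * t) - ‖x - Z x‖ ^ 2 / (4 * t) - ‖y‖ ^ 2 / (4 * t)
       + ‖y - Z x‖ ^ 2 / (4 * t) := by ring
    linarith
  have := hlip.continuous.sub (g := fun x : E => ‖x‖ ^ 2 / (4 * t)) (by fun_prop)
  simpa [Pi.sub_def] using this

/-- Lasry–Lions regularization of a function continuous on a compact set. -/
lemma exists_lasryLions [FiniteDimensional ℝ E] {K : Set E} (hK : IsCompact K)
    (hKne : K.Nonempty) {g : E → ℝ} (hg : ContinuousOn g K) {t : ℝ} (ht : 0 < t) :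
    ∃ (φ : E → ℝ) (p : E → E),
      (∀ y, ∀ z ∈ K, g z - ‖y - z‖ ^ 2 / (2 * t) ≤ φ y) ∧
      (∀ y, ∃ z ∈ K, φ y ≤ g z - ‖y - z‖ ^ 2 / (4 * t)) ∧
      (∀ y k, |φ (y + k) - φ y - ⟪p y, k⟫| ≤ 3 / (2 * t) * ‖k‖ ^ 2) ∧
      (∀ y c, c < 1 / (2 * t) → (∀ k, φ (y + k) ≤ φ y + ⟪p y, k⟫ + c * ‖k‖ ^ 2) →
        y + t • p y ∈ K ∧ ∀ k, y + t • p y + k ∈ K →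
          g (y + t • p y + k) ≤ g (y + t • p y) + (φ (y + k) - φ y)) := by
  obtain ⟨s, hsc, hsz, hs⟩ := exists_supConvolution hK hKne hg ht
  have hex : ∀ y : E, ∃ x, ∀ x', s x + ‖x - y‖ ^ 2 / (2 * t) ≤ s x' + ‖x' - y‖ ^ 2 / (2 * t) := by
    intro y
    refine Continuous.exists_forall_le (f := fun x => s x + ‖x - y‖ ^ 2 / (2 * t)) (by fun_prop) ?_
    obtain ⟨z, hz⟩ := hKne
    have hlow : ∀ x, (g z - 3 * ‖y - z‖ ^ 2 / (4 * t)) + ‖x - y‖ ^ 2 / (8 * t)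
        ≤ s x + ‖x - y‖ ^ 2 / (2 * t) := by
      intro x
      have h1 := hs x z hz
      have h2 : ‖x - z‖ ≤ ‖x - y‖ + ‖y - z‖ := norm_sub_le_norm_sub_add_norm_sub x y z
      have h3 : ‖x - z‖ ^ 2 ≤ 3 / 2 * ‖x - y‖ ^ 2 + 3 * ‖y - z‖ ^ 2 := by
        nlinarith [norm_nonneg (x - z), sq_nonneg (‖x - y‖ - 2 * ‖y - z‖)]
      have h4 : ‖x - z‖ ^ 2 / (4 * t) ≤ (3 / 2 * ‖x - y‖ ^ 2 + 3 * ‖y - z‖ ^ 2) / (4 * t) := by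
        gcongr
      have e : (3 / 2 * ‖x - y‖ ^ 2 + 3 * ‖y - z‖ ^ 2) / (4 * t) =
        ‖x - y‖ ^ 2 / (2 * t) - ‖x - y‖ ^ 2 / (8 * t) + 3 * ‖y - z‖ ^ 2 / (4 * t) := by
        field_simp; ring
      linarith
    refine tendsto_atTop_mono hlow (tendsto_atTop_add_const_left _ _ ?_)
    refine Tendsto.atTop_div_const (by positivity) ?_
    refine (tendsto_pow_atTop two_ne_zero).comp ?_
    refine tendsto_atTop_mono (f := fun x => ‖x‖ - ‖y‖) (fun x => norm_sub_norm_le x y) ?_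
    exact tendsto_atTop_add_const_right _ _ (tendsto_norm_cocompact_atTop)
  choose X hX using hex
  set φ : E → ℝ := fun y => s (X y) + ‖X y - y‖ ^ 2 / (2 * t) with hφ
  have hle : ∀ y x, φ y ≤ s x + ‖x - y‖ ^ 2 / (2 * t) := fun y x => hX y x
  have hlow : ∀ y, ∀ z ∈ K, g z - ‖y - z‖ ^ 2 / (2 * t) ≤ φ y := by
    intro y z hz
    have h1 := hs (X y) z hz
    have h2 : ‖X y - z‖ ^ 2 ≤ 2 * ‖X y - y‖ ^ 2 + 2 * ‖y - z‖ ^ 2 := by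
      have := norm_sub_le_norm_sub_add_norm_sub (X y) y z
      nlinarith [norm_nonneg (X y - z), sq_nonneg (‖X y - y‖ - ‖y - z‖)]
    have h4 : ‖X y - z‖ ^ 2 / (4 * t) ≤ (2 * ‖X y - y‖ ^ 2 + 2 * ‖y - z‖ ^ 2) / (4 * t) := by
      gcongr
    have e : (2 * ‖X y - y‖ ^ 2 + 2 * ‖y - z‖ ^ 2) / (4 * t) =
        ‖X y - y‖ ^ 2 / (2 * t) + ‖y - z‖ ^ 2 / (2 * t) := by field_simp; ring
    simp only [hφ]; linarith
  have hup : ∀ y k, φ (y + k) ≤ φ y + ⟪t⁻¹ • (y - X y), k⟫ + ‖k‖ ^ 2 / (2 * t) := by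
    intro y k
    have h1 := hle (y + k) (X y)
    have e : ‖X y - (y + k)‖ ^ 2 = ‖X y - y‖ ^ 2 + 2 * ⟪y - X y, k⟫ + ‖k‖ ^ 2 := by
      rw [show X y - (y + k) = (X y - y) - k by abel, norm_sub_sq_real, ← neg_sub y (X y),
        inner_neg_left, norm_neg]; ring
    rw [e] at h1
    rw [inner_smul_left, RCLike.conj_to_real]
    have e2 : (‖X y - y‖ ^ 2 + 2 * ⟪y - X y, k⟫ + ‖k‖ ^ 2) / (2 * t) =
      ‖X y - y‖ ^ 2 / (2 * t) + t⁻¹ * ⟪y - X y, k⟫ + ‖k‖ ^ 2 / (2 * t) := by field_simp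
    simp only [hφ] at h1 ⊢; linarith
  have hmid : ∀ y k, 2 * φ y - ‖k‖ ^ 2 / t ≤ φ (y + k) + φ (y - k) := by
    intro y k
    set a := X (y + k) with ha
    set b := X (y - k) with hb
    set x := (1 / 2 : ℝ) • (a + b) with hx
    set d := (1 / 2 : ℝ) • (a - b) with hd
    have hax : a = x + d := by rw [hx, hd]; module
    have hbx : b = x - d := by rw [hx, hd]; module
    obtain ⟨z, hz, hsxz⟩ := hsz x
    have h1 := hle y x
    have h2 := hs a z hz
    have h3 := hs b z hz
    have e1 := parallelogram_law_with_norm ℝ (x - z) d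
    have e2 := parallelogram_law_with_norm ℝ (x - y) (d - k)
    have e3 : ‖d‖ ^ 2 ≤ 2 * ‖d - k‖ ^ 2 + 2 * ‖k‖ ^ 2 := by
      have : ‖d‖ ≤ ‖d - k‖ + ‖k‖ := by simpa using norm_add_le (d - k) k
      nlinarith [norm_nonneg d, sq_nonneg (‖d - k‖ - ‖k‖)]
    have f1 : φ (y + k) = s a + ‖a - (y + k)‖ ^ 2 / (2 * t) := rfl
    have f2 : φ (y - k) = s b + ‖b - (y - k)‖ ^ 2 / (2 * t) := rfl
    rw [f1, f2]
    rw [hsxz] at h1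
    have g1 : a - z = x - z + d := by rw [hax]; abel
    have g2 : b - z = x - z - d := by rw [hbx]; abel
    have g3 : a - (y + k) = x - y + (d - k) := by rw [hax]; abel
    have g4 : b - (y - k) = x - y - (d - k) := by rw [hbx]; abel
    rw [g1] at h2
    rw [g2] at h3
    rw [g3, g4]
    have key : 0 ≤ (2 * (‖x - y + (d - k)‖ ^ 2 + ‖x - y - (d - k)‖ ^ 2)
        - (‖x - z + d‖ ^ 2 + ‖x - z - d‖ ^ 2)
        + 2 * ‖x - z‖ ^ 2 - 4 * ‖x - y‖ ^ 2 + 4 * ‖k‖ ^ 2) / (4 * t) := by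
      apply div_nonneg _ (by positivity)
      nlinarith
    have e4 : (2 * (‖x - y + (d - k)‖ ^ 2 + ‖x - y - (d - k)‖ ^ 2)
        - (‖x - z + d‖ ^ 2 + ‖x - z - d‖ ^ 2)
        + 2 * ‖x - z‖ ^ 2 - 4 * ‖x - y‖ ^ 2 + 4 * ‖k‖ ^ 2) / (4 * t) =
        ‖x - y + (d - k)‖ ^ 2 / (2 * t) + ‖x - y - (d - k)‖ ^ 2 / (2 * t)
        - ‖x - z + d‖ ^ 2 / (4 * t) - ‖x - z - d‖ ^ 2 / (4 * t)
        + 2 * (‖x - z‖ ^ 2 / (4 * t)) - 2 * (‖x - y‖ ^ 2 / (2 * t)) + ‖k‖ ^ 2 / t := by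
      field_simp; ring
    linarith
  refine ⟨φ, fun y => t⁻¹ • (y - X y), hlow, fun y => ?_, fun y k => ?_, fun y c hc hk => ?_⟩
  · obtain ⟨z, hz, h⟩ := hsz y
    refine ⟨z, hz, ?_⟩
    have := hle y y
    simp only [sub_self, norm_zero] at this
    rw [← h]; simpa using this
  · have h1 := hup y k
    have h2 := hup y (-k)
    have h3 := hmid y k
    rw [inner_neg_right, norm_neg, ← sub_eq_add_neg] at h2
    have e : 3 / (2 * t) * ‖k‖ ^ 2 = ‖k‖ ^ 2 / t + ‖k‖ ^ 2 / (2 * t) := by field_simp; ring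
    have e0 : 0 ≤ ‖k‖ ^ 2 / t := by positivity
    rw [e, abs_le]
    constructor <;> linarith
  · obtain ⟨z, hz, hsxz⟩ := hsz (X y)
    set x := X y with hx
    have hy : φ y = g z - ‖x - z‖ ^ 2 / (4 * t) + ‖x - y‖ ^ 2 / (2 * t) := by rw [← hsxz]
    set k := (1 / 2 : ℝ) • (x + z) - y with hkdef
    have h1 := hk k
    have h2 := hlow (y + k) z hz
    have e1 : y + k - z = (1 / 2 : ℝ) • (x - z) := by rw [hkdef]; module
    have e1' : x - y - k = (1 / 2 : ℝ) • (x - z) := by rw [hkdef]; module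
    have e2 : ‖(1 / 2 : ℝ) • (x - z)‖ ^ 2 = ‖x - z‖ ^ 2 / 4 := by
      rw [norm_smul, Real.norm_of_nonneg (by norm_num)]; ring
    have e3 := norm_sub_sq_real (x - y) k
    rw [e1', e2] at e3
    rw [e1, e2] at h2
    rw [inner_smul_left, RCLike.conj_to_real, ← neg_sub x y, inner_neg_left] at h1
    have hk0 : k = 0 := by
      have : (1 / (2 * t) - c) * ‖k‖ ^ 2 ≤ 0 := by
        have e4 : (‖x - z‖ ^ 2 / 4) / (2 * t) = ‖x - y‖ ^ 2 / (2 * t) - t⁻¹ * ⟪x - y, k⟫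
          + 1 / (2 * t) * ‖k‖ ^ 2 := by rw [e3]; field_simp
        have e5 : ‖x - z‖ ^ 2 / (4 * t) = 2 * ((‖x - z‖ ^ 2 / 4) / (2 * t)) := by
          field_simp
        linarith
      have h0 : ‖k‖ ^ 2 ≤ 0 := nonpos_of_mul_nonpos_right this (by linarith)
      exact norm_eq_zero.1 (pow_eq_zero_iff two_ne_zero |>.1 (le_antisymm h0 (by positivity)))
    have hyz : y + t • t⁻¹ • (y - x) = z := by
      rw [smul_smul, mul_inv_cancel₀ ht.ne', one_smul]
      have : y = (1 / 2 : ℝ) • (x + z) := by rw [hk0] at hkdef; exact (sub_eq_zero.1 hkdef.symm).symm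
      have h2 : (2 : ℝ) • y = x + z := by rw [this]; module
      have : y + (y - x) = (2 : ℝ) • y - x := by module
      rw [this, h2]; abel
    have hyk : φ y = g z - ‖y - z‖ ^ 2 / (2 * t) := by
      have e6 : y - z = (1 / 2 : ℝ) • (x - z) := by rw [← e1, hk0, add_zero]
      have e7 : x - y = (1 / 2 : ℝ) • (x - z) := by rw [← e1', hk0, sub_zero]
      rw [hy, e6, e7, e2]
      field_simp; ring
    simp only
    rw [hyz]
    refine ⟨hz, fun k hk => ?_⟩
    have := hlow (y + k) _ hk
    rw [show y + k - (z + k) = y - z by abel] at this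
    linarith
end Regularization

section TheoremOnSums

variable {E : Type*} [NormedAddCommGroup E] [InnerProductSpace ℝ E]

lemma hasFDerivAt_of_quadratic_bound {φ : E → ℝ} {v : E} {c : ℝ} {y : E}
    (h : ∀ k, |φ (y + k) - φ y - ⟪v, k⟫| ≤ c * ‖k‖ ^ 2) :
    HasFDerivAt φ (innerSL ℝ v) y := by
  rw [hasFDerivAt_iff_isLittleO_nhds_zero]
  have h1 : (fun k => φ (y + k) - φ y - innerSL ℝ v k) =O[𝓝 0] fun k : E => ‖k‖ ^ 2 :=
    Asymptotics.IsBigO.of_bound c (Eventually.of_forall fun k => by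
      simpa [Real.norm_eq_abs] using h k)
  exact h1.trans_isLittleO (Asymptotics.isLittleO_norm_pow_id one_lt_two)

/-- Second order Taylor expansion at a point where the slope is differentiable. -/
lemma eventually_taylor_two {φ : E → ℝ} {p : E → E} {c : ℝ} {D : E →L[ℝ] E} {y : E}
    (h : ∀ y k, |φ (y + k) - φ y - ⟪p y, k⟫| ≤ c * ‖k‖ ^ 2) (hD : HasFDerivAt p D y)
    {δ : ℝ} (hδ : 0 < δ) :
    ∀ᶠ k in 𝓝 (0 : E), |φ (y + k) - φ y - ⟪p y, k⟫ - 1 / 2 * ⟪D k, k⟫| ≤ δ * ‖k‖ ^ 2 := by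
  rw [hasFDerivAt_iff_isLittleO_nhds_zero] at hD
  obtain ⟨r, hr, hball⟩ := Metric.eventually_nhds_iff_ball.1 (hD.def hδ)
  refine Metric.eventually_nhds_iff_ball.2 ⟨r, hr, fun k hk => ?_⟩
  rw [mem_ball_zero_iff] at hk
  set ρ : ℝ → ℝ := fun s => φ (y + s • k) - s * ⟪p y, k⟫ - s ^ 2 / 2 * ⟪D k, k⟫ with hρ
  have hder : ∀ s, HasDerivAt ρ (⟪p (y + s • k), k⟫ - ⟪p y, k⟫ - s * ⟪D k, k⟫) s := by
    intro s
    have h1 : HasDerivAt (fun s : ℝ => y + s • k) k s := by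
      simpa using ((hasDerivAt_id s).smul_const k).const_add y
    have h2 := (hasFDerivAt_of_quadratic_bound (h (y + s • k))).comp_hasDerivAt s h1
    have h3 : HasDerivAt (fun s : ℝ => s * ⟪p y, k⟫) ⟪p y, k⟫ s := by
      simpa using (hasDerivAt_id s).mul_const ⟪p y, k⟫
    have h4 : HasDerivAt (fun s : ℝ => s ^ 2 / 2 * ⟪D k, k⟫) (s * ⟪D k, k⟫) s := by
      have := (((hasDerivAt_id s).pow 2).div_const 2).mul_const ⟪D k, k⟫
      simpa using this
    exact (h2.sub h3).sub h4
  have hb := norm_image_sub_le_of_norm_deriv_le_segment_01' (f := ρ) (C := δ * ‖k‖ ^ 2)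
    (fun s _ => (hder s).hasDerivWithinAt) (fun s hs => by
      have hsk : ‖s • k‖ ≤ ‖k‖ := by
        rw [norm_smul, Real.norm_of_nonneg hs.1]
        nlinarith [norm_nonneg k, hs.2]
      have h1 := hball (s • k) (by rw [mem_ball_zero_iff]; exact hsk.trans_lt hk)
      have e : ⟪p (y + s • k), k⟫ - ⟪p y, k⟫ - s * ⟪D k, k⟫
          = ⟪p (y + s • k) - p y - D (s • k), k⟫ := by
        rw [inner_sub_left, inner_sub_left, map_smul, inner_smul_left, RCLike.conj_to_real]
      rw [e]
      calc ‖⟪p (y + s • k) - p y - D (s • k), k⟫‖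
          ≤ ‖p (y + s • k) - p y - D (s • k)‖ * ‖k‖ := norm_inner_le_norm _ _
        _ ≤ (δ * ‖s • k‖) * ‖k‖ := by gcongr
        _ ≤ (δ * ‖k‖) * ‖k‖ := by gcongr
        _ = δ * ‖k‖ ^ 2 := by ring)
  simp only [hρ, one_smul, zero_smul, add_zero, Real.norm_eq_abs] at hb
  convert hb using 2
  ring

/-- A Lipschitz map whose image contains a nonempty open set cannot be supported on a set on
which an almost everywhere property fails. -/
lemma exists_mem_of_ball_subset_image {F : Type*} [NormedAddCommGroup F] [NormedSpace ℝ F]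
    [FiniteDimensional ℝ F] [MeasurableSpace F] [BorelSpace F] {μ : Measure F}
    [μ.IsAddHaarMeasure] {G : F → F} {C : ℝ≥0} (hG : LipschitzWith C G) {S : Set F} {r : ℝ}
    (hr : 0 < r) (hS : ball 0 r ⊆ G '' S) {P : F → Prop} (hP : ∀ᵐ x ∂μ, P x) :
    ∃ x ∈ S, P x := by
  by_contra! hcon
  have h0 : μ S = 0 := measure_mono_null (fun x hx => hcon x hx) hP
  have h1 : Measure.hausdorffMeasure (Module.finrank ℝ F : ℝ) S = 0 :=
    Measure.absolutelyContinuous_isAddHaarMeasure _ μ h0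
  have h2 : Measure.hausdorffMeasure (Module.finrank ℝ F : ℝ) (G '' S) = 0 := by
    refine le_antisymm ((hG.hausdorffMeasure_image_le (Nat.cast_nonneg _) S).trans ?_) bot_le
    rw [h1, mul_zero]
  have h3 := measure_mono_null hS h2
  exact (Metric.measure_ball_pos (Measure.hausdorffMeasure (Module.finrank ℝ F : ℝ))
    (0 : F) hr).ne' h3

/-- The coupling form `⟨P (h - k), h - k⟩ + c (|h|² + |k|²)`. -/
def couplingForm (P : E →L[ℝ] E) (c : ℝ) (h k : E) : ℝ :=
  ⟪P (h - k), h - k⟫ + c * (‖h‖ ^ 2 + ‖k‖ ^ 2)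

/-- The gradient of the coupling form, as a linear map. -/
def couplingGrad (P : E →L[ℝ] E) (c : ℝ) : E × E →L[ℝ] E × E :=
  (((2 : ℝ) • P).comp (ContinuousLinearMap.fst ℝ E E - ContinuousLinearMap.snd ℝ E E) +
    (2 * c) • ContinuousLinearMap.fst ℝ E E).prod
  (-((2 : ℝ) • P).comp (ContinuousLinearMap.fst ℝ E E - ContinuousLinearMap.snd ℝ E E) +
    (2 * c) • ContinuousLinearMap.snd ℝ E E)

lemma couplingForm_add {P : E →L[ℝ] E} (hP : ∀ a b, ⟪P a, b⟫ = ⟪a, P b⟫) (c : ℝ)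
    (x y h k : E) :
    couplingForm P c (x + h) (y + k) = couplingForm P c x y
      + ⟪(couplingGrad P c (x, y)).1, h⟫ + ⟪(couplingGrad P c (x, y)).2, k⟫
      + couplingForm P c h k := by
  have e : x + h - (y + k) = (x - y) + (h - k) := by abel
  have h1 : ⟪P (h - k), x - y⟫ = ⟪P (x - y), h - k⟫ := by rw [hP, real_inner_comm]
  simp only [couplingForm, couplingGrad, e, map_add, inner_add_left, inner_add_right, h1,
    norm_add_sq_real, ContinuousLinearMap.prod_apply, _root_.add_apply,
    ContinuousLinearMap.comp_apply, _root_.sub_apply, _root_.neg_apply,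
    _root_.smul_apply, ContinuousLinearMap.coe_fst', ContinuousLinearMap.coe_snd',
    inner_smul_left, inner_neg_left, RCLike.conj_to_real]
  rw [inner_sub_right (P (x - y)) h k]
  ring

lemma couplingGrad_fst_le (P : E →L[ℝ] E) (c : ℝ) (x y : E) :
    ‖(couplingGrad P c (x, y)).1‖ ≤ 2 * (‖P‖ + |c|) * (‖x‖ + ‖y‖) := by
  have h1 : ‖P (x - y)‖ ≤ ‖P‖ * (‖x‖ + ‖y‖) :=
    (P.le_opNorm _).trans (by gcongr; exact norm_sub_le _ _)
  have : (couplingGrad P c (x, y)).1 = (2 : ℝ) • P (x - y) + (2 * c) • x := by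
    simp [couplingGrad, smul_sub]
  rw [this]
  refine (norm_add_le _ _).trans ?_
  rw [norm_smul, norm_smul, Real.norm_eq_abs, Real.norm_eq_abs, abs_mul, abs_two]
  nlinarith [abs_nonneg c, norm_nonneg x, norm_nonneg y, mul_nonneg (abs_nonneg c) (norm_nonneg y)]

lemma couplingGrad_snd_le (P : E →L[ℝ] E) (c : ℝ) (x y : E) :
    ‖(couplingGrad P c (x, y)).2‖ ≤ 2 * (‖P‖ + |c|) * (‖x‖ + ‖y‖) := by
  have h1 : ‖P (x - y)‖ ≤ ‖P‖ * (‖x‖ + ‖y‖) :=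
    (P.le_opNorm _).trans (by gcongr; exact norm_sub_le _ _)
  have : (couplingGrad P c (x, y)).2 = -((2 : ℝ) • P (x - y)) + (2 * c) • y := by
    simp [couplingGrad, smul_sub]
  rw [this]
  refine (norm_add_le _ _).trans ?_
  rw [norm_neg, norm_smul, norm_smul, Real.norm_eq_abs, Real.norm_eq_abs, abs_mul, abs_two]
  nlinarith [abs_nonneg c, norm_nonneg x, norm_nonneg y, mul_nonneg (abs_nonneg c) (norm_nonneg x)]

lemma abs_couplingForm_le (P : E →L[ℝ] E) (c : ℝ) (h k : E) :
    |couplingForm P c h k| ≤ 2 * (‖P‖ + |c|) * (‖h‖ ^ 2 + ‖k‖ ^ 2) := by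
  have h1 : |⟪P (h - k), h - k⟫| ≤ ‖P‖ * (2 * (‖h‖ ^ 2 + ‖k‖ ^ 2)) := by
    calc |⟪P (h - k), h - k⟫| ≤ ‖P (h - k)‖ * ‖h - k‖ := abs_real_inner_le_norm _ _
      _ ≤ (‖P‖ * ‖h - k‖) * ‖h - k‖ := by gcongr; exact P.le_opNorm _
      _ = ‖P‖ * ‖h - k‖ ^ 2 := by ring
      _ ≤ _ := by
        gcongr
        have := norm_sub_le h k
        nlinarith [norm_nonneg (h - k), sq_nonneg (‖h‖ - ‖k‖)]
  have h2 : |c * (‖h‖ ^ 2 + ‖k‖ ^ 2)| = |c| * (‖h‖ ^ 2 + ‖k‖ ^ 2) := by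
    rw [abs_mul, abs_of_nonneg (by positivity : 0 ≤ ‖h‖ ^ 2 + ‖k‖ ^ 2)]
  rw [couplingForm]
  refine (abs_add_le _ _).trans ?_
  rw [h2]
  nlinarith [mul_nonneg (abs_nonneg c) (by positivity : 0 ≤ ‖h‖ ^ 2 + ‖k‖ ^ 2)]

lemma couplingForm_smul (P : E →L[ℝ] E) (c s : ℝ) (h k : E) :
    couplingForm P c (s • h) (s • k) = s ^ 2 * couplingForm P c h k := by
  simp only [couplingForm, ← smul_sub, map_smul, inner_smul_left, inner_smul_right, norm_smul,
    mul_pow, Real.norm_eq_abs, sq_abs, RCLike.conj_to_real]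
  ring

lemma coupled_upper_bound {P : E →L[ℝ] E} (hP : ∀ a b, ⟪P a, b⟫ = ⟪a, P b⟫) {c η t G : ℝ}
    (hη : 0 < η) (ht : 1 / (4 * t) = 2 * (‖P‖ + |c|) + 8 * (‖P‖ + |c|) ^ 2 / η + η / 2)
    {x y z w : E} (hG : G ≤ couplingForm P c z w - η * (‖z‖ ^ 2 + ‖w‖ ^ 2)) :
    G - ‖x - z‖ ^ 2 / (4 * t) - ‖y - w‖ ^ 2 / (4 * t) - couplingForm P c x y ≤
      -(η / 4) * (‖x‖ ^ 2 + ‖y‖ ^ 2) := by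
  set m := ‖P‖ + |c| with hm
  have hm0 : 0 ≤ m := by positivity
  obtain ⟨a, rfl⟩ : ∃ a, x = z + a := ⟨x - z, by abel⟩
  obtain ⟨b, rfl⟩ : ∃ b, y = w + b := ⟨y - w, by abel⟩
  rw [add_sub_cancel_left, add_sub_cancel_left, couplingForm_add hP]
  have h1 : -(2 * m * (‖z‖ + ‖w‖) * ‖a‖) ≤ ⟪(couplingGrad P c (z, w)).1, a⟫ := by
    refine (neg_le_neg ?_).trans (neg_le_of_abs_le (abs_real_inner_le_norm _ _))
    gcongr; exact couplingGrad_fst_le P c z w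
  have h2 : -(2 * m * (‖z‖ + ‖w‖) * ‖b‖) ≤ ⟪(couplingGrad P c (z, w)).2, b⟫ := by
    refine (neg_le_neg ?_).trans (neg_le_of_abs_le (abs_real_inner_le_norm _ _))
    gcongr; exact couplingGrad_snd_le P c z w
  have h3 := (abs_le.1 (abs_couplingForm_le P c a b)).1
  rw [← hm] at h3
  have h4 : ‖a‖ ^ 2 / (4 * t) + ‖b‖ ^ 2 / (4 * t) =
      (2 * m + 8 * m ^ 2 / η + η / 2) * (‖a‖ ^ 2 + ‖b‖ ^ 2) := by rw [← ht]; ring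
  have h5 : 2 * m * (‖z‖ + ‖w‖) * (‖a‖ + ‖b‖) ≤
      η / 2 * (‖z‖ ^ 2 + ‖w‖ ^ 2) + 8 * m ^ 2 / η * (‖a‖ ^ 2 + ‖b‖ ^ 2) := by
    have e1 : 8 * m ^ 2 / η * (‖a‖ ^ 2 + ‖b‖ ^ 2) =
      η * (8 * (m / η) ^ 2 * (‖a‖ ^ 2 + ‖b‖ ^ 2)) := by field_simp
    have e2 : 2 * m * (‖z‖ + ‖w‖) * (‖a‖ + ‖b‖) =
      η * (2 * (m / η) * (‖z‖ + ‖w‖) * (‖a‖ + ‖b‖)) := by field_simp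
    have e3 : η / 2 * (‖z‖ ^ 2 + ‖w‖ ^ 2) = η * ((‖z‖ ^ 2 + ‖w‖ ^ 2) / 2) := by ring
    rw [e1, e2, e3, ← mul_add]
    refine mul_le_mul_of_nonneg_left ?_ hη.le
    set k := m / η
    nlinarith [sq_nonneg ((‖z‖ + ‖w‖) / 2 - 2 * k * (‖a‖ + ‖b‖)), sq_nonneg (‖z‖ - ‖w‖),
      mul_nonneg (sq_nonneg k) (sq_nonneg (‖a‖ - ‖b‖))]
  have h6 : ‖z + a‖ ^ 2 ≤ 2 * ‖z‖ ^ 2 + 2 * ‖a‖ ^ 2 := by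
    have := norm_add_le z a
    nlinarith [norm_nonneg (z + a), sq_nonneg (‖z‖ - ‖a‖)]
  have h7 : ‖w + b‖ ^ 2 ≤ 2 * ‖w‖ ^ 2 + 2 * ‖b‖ ^ 2 := by
    have := norm_add_le w b
    nlinarith [norm_nonneg (w + b), sq_nonneg (‖w‖ - ‖b‖)]
  nlinarith

/-- A quadratic form that is bounded above by `o(s²)` along each ray is nonpositive. -/
lemma nonpos_of_forall_eventually_le {a b : ℝ}
    (h : ∀ δ > 0, ∀ᶠ s : ℝ in 𝓝 0, s ^ 2 * a ≤ δ * (s ^ 2 * b)) : a ≤ 0 := by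
  by_contra! ha
  have hb : 0 < |b| + 1 := by positivity
  obtain ⟨ε, hε, hs⟩ := Metric.eventually_nhds_iff_ball.1 (h (a / (2 * (|b| + 1))) (by positivity))
  have h1 := hs (ε / 2) (by rw [mem_ball_zero_iff, Real.norm_of_nonneg (by positivity)]; linarith)
  have h2 : a ≤ a / (2 * (|b| + 1)) * b := by
    have : 0 < (ε / 2) ^ 2 := by positivity
    refine le_of_mul_le_mul_left ?_ this
    linarith
  have h3 : a / (2 * (|b| + 1)) * b ≤ a / (2 * (|b| + 1)) * (|b| + 1) := by
    gcongr; linarith [le_abs_self b]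
  have h4 : a / (2 * (|b| + 1)) * (|b| + 1) = a / 2 := by field_simp
  linarith

/-- Theorem on sums for a quadratic coupling: if `g₁(x) + g₂(y)` is touched from above at the
origin by a quadratic form, with a quadratic gap, then near the origin both functions are touched
from above by paraboloids whose Hessians are jointly controlled by that of the form. -/
theorem theorem_on_sums [FiniteDimensional ℝ E] {g₁ g₂ : E → ℝ} {P : E →L[ℝ] E}
    (hP : ∀ a b, ⟪P a, b⟫ = ⟪a, P b⟫) {c η ρ : ℝ} (hη : 0 < η) (hρ : 0 < ρ)
    (hg₁ : ContinuousOn g₁ (closedBall 0 ρ)) (hg₂ : ContinuousOn g₂ (closedBall 0 ρ))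
    (h0 : 0 ≤ g₁ 0 + g₂ 0)
    (hle : ∀ x ∈ closedBall (0 : E) ρ, ∀ y ∈ closedBall (0 : E) ρ,
      g₁ x + g₂ y ≤ couplingForm P c x y - η * (‖x‖ ^ 2 + ‖y‖ ^ 2))
    {δ : ℝ} (hδ : 0 < δ) :
    ∃ (z₁ z₂ a₁ a₂ : E) (D₁ D₂ : E →L[ℝ] E), ‖z₁‖ < δ ∧ ‖z₂‖ < δ ∧ ‖a₁‖ < δ ∧ ‖a₂‖ < δ ∧
      (∀ᶠ k in 𝓝 (0 : E), g₁ (z₁ + k) ≤ g₁ z₁ + ⟪a₁, k⟫ + 1 / 2 * ⟪D₁ k, k⟫ + δ * ‖k‖ ^ 2) ∧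
      (∀ᶠ k in 𝓝 (0 : E), g₂ (z₂ + k) ≤ g₂ z₂ + ⟪a₂, k⟫ + 1 / 2 * ⟪D₂ k, k⟫ + δ * ‖k‖ ^ 2) ∧
      ∀ h k, 1 / 2 * ⟪D₁ h, h⟫ + 1 / 2 * ⟪D₂ k, k⟫ ≤ couplingForm P c h k := by
  borelize E
  set m := ‖P‖ + |c| with hm
  have hm0 : 0 ≤ m := by positivity
  obtain ⟨t, ht0, ht⟩ : ∃ t : ℝ, 0 < t ∧ 1 / (4 * t) = 2 * m + 8 * m ^ 2 / η + η / 2 :=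
    ⟨1 / (4 * (2 * m + 8 * m ^ 2 / η + η / 2)), by positivity, by field_simp⟩
  have hK : IsCompact (closedBall (0 : E) ρ) := isCompact_closedBall _ _
  have h0K : (0 : E) ∈ closedBall (0 : E) ρ := mem_closedBall_self hρ.le
  obtain ⟨φ₁, p₁, low₁, up₁, quad₁, touch₁⟩ := exists_lasryLions hK ⟨0, h0K⟩ hg₁ ht0
  obtain ⟨φ₂, p₂, low₂, up₂, quad₂, touch₂⟩ := exists_lasryLions hK ⟨0, h0K⟩ hg₂ ht0
  have hc₁ : Continuous φ₁ := continuous_iff_continuousAt.2 fun y =>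
    (hasFDerivAt_of_quadratic_bound (quad₁ y)).continuousAt
  have hc₂ : Continuous φ₂ := continuous_iff_continuousAt.2 fun y =>
    (hasFDerivAt_of_quadratic_bound (quad₂ y)).continuousAt
  have hΨ : ∀ x y, φ₁ x + φ₂ y - couplingForm P c x y ≤ -(η / 4) * (‖x‖ ^ 2 + ‖y‖ ^ 2) := by
    intro x y
    obtain ⟨z, hz, hz'⟩ := up₁ x
    obtain ⟨w, hw, hw'⟩ := up₂ y
    have := coupled_upper_bound hP hη ht (x := x) (y := y) (hle z hz w hw)
    linarith
  have hΨ0 : 0 ≤ φ₁ 0 + φ₂ 0 := by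
    have h1 := low₁ 0 0 h0K
    have h2 := low₂ 0 0 h0K
    simp only [sub_self, norm_zero] at h1 h2
    norm_num at h1 h2
    linarith
  have hform0 : couplingForm P c (0 : E) 0 = 0 := by simp [couplingForm]
  obtain ⟨r, hr0, hrδ⟩ : ∃ r : ℝ, 0 < r ∧
      (1 + t) * (2 * m * (8 * r / η) + r) + 8 * r / η < min δ ρ := by
    refine ⟨min δ ρ / (2 * ((1 + t) * (2 * m * (8 / η) + 1) + 8 / η)), by positivity, ?_⟩
    have hA : 0 < (1 + t) * (2 * m * (8 / η) + 1) + 8 / η := by positivity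
    have hmin : 0 < min δ ρ := by positivity
    generalize hAe : (1 + t) * (2 * m * (8 / η) + 1) + 8 / η = A at hA
    have : ∀ r : ℝ, (1 + t) * (2 * m * (8 * r / η) + r) + 8 * r / η = A * r := by
      intro r; rw [← hAe]; ring
    rw [this]
    have : A * (min δ ρ / (2 * A)) = min δ ρ / 2 := by field_simp
    rw [this]; linarith
  set G : E × E → E × E := fun ζ => (p₁ ζ.1, p₂ ζ.2) - couplingGrad P c ζ with hG
  have hGlip : LipschitzWith _ G :=
    (((lipschitzWith_of_quadratic_bound quad₁).comp LipschitzWith.prod_fst).prodMk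
      ((lipschitzWith_of_quadratic_bound quad₂).comp LipschitzWith.prod_snd)).sub
      (couplingGrad P c).lipschitz
  set S : Set (E × E) := {ζ | ‖(G ζ).1‖ < r ∧ ‖(G ζ).2‖ < r ∧ ‖ζ.1‖ + ‖ζ.2‖ ≤ 8 * r / η ∧
    ∀ h k, φ₁ (ζ.1 + h) + φ₂ (ζ.2 + k) ≤ φ₁ ζ.1 + φ₂ ζ.2 + ⟪p₁ ζ.1, h⟫ + ⟪p₂ ζ.2, k⟫
      + couplingForm P c h k} with hS
  have hball : ball 0 r ⊆ G '' S := by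
    rintro ⟨q₁, q₂⟩ hq
    rw [mem_ball_zero_iff, Prod.norm_def, max_lt_iff] at hq
    obtain ⟨hq₁, hq₂⟩ := hq
    simp only at hq₁ hq₂
    set f : E × E → ℝ := fun ζ => φ₁ ζ.1 + φ₂ ζ.2 - couplingForm P c ζ.1 ζ.2 - ⟪q₁, ζ.1⟫ - ⟪q₂, ζ.2⟫
      with hf
    have hfle : ∀ ζ, f ζ ≤ -(η / 4) * (‖ζ.1‖ ^ 2 + ‖ζ.2‖ ^ 2) + r * (‖ζ.1‖ + ‖ζ.2‖) := by
      intro ζ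
      have h1 := hΨ ζ.1 ζ.2
      have h2 : -⟪q₁, ζ.1⟫ ≤ r * ‖ζ.1‖ := (neg_le_abs _).trans
        ((abs_real_inner_le_norm _ _).trans (by gcongr))
      have h3 : -⟪q₂, ζ.2⟫ ≤ r * ‖ζ.2‖ := (neg_le_abs _).trans
        ((abs_real_inner_le_norm _ _).trans (by gcongr))
      simp only [hf]; linarith
    have hf0 : 0 ≤ f 0 := by simpa [hf, hform0] using hΨ0
    have hneg : ∀ ζ, 8 * r / η < ‖ζ.1‖ + ‖ζ.2‖ → f ζ < 0 := by
      intro ζ hζ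
      refine (hfle ζ).trans_lt ?_
      have h1 : 8 * r < (‖ζ.1‖ + ‖ζ.2‖) * η := (div_lt_iff₀ hη).1 hζ
      have h2 : 0 < ‖ζ.1‖ + ‖ζ.2‖ := lt_trans (by positivity) hζ
      have h3 := mul_lt_mul_of_pos_right h1 h2
      nlinarith [mul_nonneg hη.le (sq_nonneg (‖ζ.1‖ - ‖ζ.2‖))]
    have hfc : Continuous f := by
      simp only [hf, couplingForm]
      have h1 : Continuous fun ζ : E × E => φ₁ ζ.1 := hc₁.comp continuous_fst
      have h2 : Continuous fun ζ : E × E => φ₂ ζ.2 := hc₂.comp continuous_snd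
      fun_prop
    obtain ⟨ζ, hζ⟩ := hfc.exists_forall_ge' (x₀ := 0) (by
      have h1 := (tendsto_norm_cocompact_atTop (E := E × E)).eventually_gt_atTop (8 * r / η)
      filter_upwards [h1] with ζ hζ
      refine (hneg ζ (hζ.trans_le ?_)).le.trans hf0
      rw [Prod.norm_def]
      exact max_le (by linarith [norm_nonneg ζ.2]) (by linarith [norm_nonneg ζ.1]))
    have hζr : ‖ζ.1‖ + ‖ζ.2‖ ≤ 8 * r / η := by
      by_contra! hcon
      linarith [hneg ζ hcon, hζ 0]
    obtain ⟨x, y⟩ := ζ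
    simp only at hζr
    have hmax : ∀ h k, φ₁ (x + h) + φ₂ (y + k) ≤ φ₁ x + φ₂ y
        + ⟪(couplingGrad P c (x, y)).1 + q₁, h⟫ + ⟪(couplingGrad P c (x, y)).2 + q₂, k⟫
        + couplingForm P c h k := by
      intro h k
      have := hζ (x + h, y + k)
      simp only [hf, couplingForm_add hP, inner_add_right] at this
      rw [inner_add_left, inner_add_left]
      linarith
    have hp₁ : p₁ x = (couplingGrad P c (x, y)).1 + q₁ := by
      refine sub_eq_zero.1 (eq_zero_of_forall_inner_le (C := 2 * m + 3 / (2 * t)) fun h => ?_)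
      have h1 := hmax h 0
      have h2 := (abs_le.1 (quad₁ x h)).1
      have h3 := (le_abs_self _).trans (abs_couplingForm_le P c h 0)
      simp only [add_zero, inner_zero_right, norm_zero] at h1 h3
      rw [inner_sub_left]
      rw [← hm] at h3
      linarith
    have hp₂ : p₂ y = (couplingGrad P c (x, y)).2 + q₂ := by
      refine sub_eq_zero.1 (eq_zero_of_forall_inner_le (C := 2 * m + 3 / (2 * t)) fun h => ?_)
      have h1 := hmax 0 h
      have h2 := (abs_le.1 (quad₂ y h)).1
      have h3 := (le_abs_self _).trans (abs_couplingForm_le P c 0 h)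
      simp only [add_zero, inner_zero_right, norm_zero] at h1 h3
      rw [inner_sub_left]
      rw [← hm] at h3
      linarith
    have hGζ : G (x, y) = (q₁, q₂) := by
      ext <;> simp [hG, hp₁, hp₂]
    refine ⟨(x, y), ⟨by rw [hGζ]; exact hq₁, by rw [hGζ]; exact hq₂, hζr, fun h k => ?_⟩, hGζ⟩
    have := hmax h k
    rwa [← hp₁, ← hp₂] at this
  have hae₁ := (lipschitzWith_of_quadratic_bound quad₁).ae_differentiableAt (μ := (volume : Measure E))
  have hae₂ := (lipschitzWith_of_quadratic_bound quad₂).ae_differentiableAt (μ := (volume : Measure E))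
  have hae : ∀ᵐ ζ : E × E ∂((volume : Measure E).prod volume),
      DifferentiableAt ℝ p₁ ζ.1 ∧ DifferentiableAt ℝ p₂ ζ.2 :=
    (Measure.quasiMeasurePreserving_fst.ae hae₁).and (Measure.quasiMeasurePreserving_snd.ae hae₂)
  obtain ⟨⟨x, y⟩, ⟨hx, hy, hxy, hmax⟩, hD₁, hD₂⟩ :=
    exists_mem_of_ball_subset_image hGlip hr0 hball hae
  simp only [hG, Prod.fst_sub, Prod.snd_sub] at hx hy hxy hmax hD₁ hD₂
  have hform₁ : ∀ h : E, couplingForm P c h 0 ≤ 2 * m * ‖h‖ ^ 2 := fun h => by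
    simpa using (le_abs_self _).trans (abs_couplingForm_le P c h 0)
  have hform₂ : ∀ h : E, couplingForm P c 0 h ≤ 2 * m * ‖h‖ ^ 2 := fun h => by
    simpa using (le_abs_self _).trans (abs_couplingForm_le P c 0 h)
  have htm : 2 * m < 1 / (2 * t) := by
    have e : 1 / (2 * t) = 2 * (1 / (4 * t)) := by field_simp; norm_num
    rw [e, ht]
    have : 0 ≤ 8 * m ^ 2 / η := by positivity
    linarith
  obtain ⟨hz₁, ht₁⟩ := touch₁ x (2 * m) htm fun k => by
    have := hmax k 0
    simp only [add_zero, inner_zero_right] at this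
    linarith [hform₁ k]
  obtain ⟨hz₂, ht₂⟩ := touch₂ y (2 * m) htm fun k => by
    have := hmax 0 k
    simp only [add_zero, inner_zero_right] at this
    linarith [hform₂ k]
  have hp₁ : ‖p₁ x‖ ≤ 2 * m * (8 * r / η) + r := by
    calc ‖p₁ x‖ = ‖(couplingGrad P c (x, y)).1 + (p₁ x - (couplingGrad P c (x, y)).1)‖ := by
          congr 1; abel
      _ ≤ 2 * m * (‖x‖ + ‖y‖) + r := (norm_add_le _ _).trans
          (add_le_add (couplingGrad_fst_le P c x y) hx.le)
      _ ≤ _ := by gcongr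
  have hp₂ : ‖p₂ y‖ ≤ 2 * m * (8 * r / η) + r := by
    calc ‖p₂ y‖ = ‖(couplingGrad P c (x, y)).2 + (p₂ y - (couplingGrad P c (x, y)).2)‖ := by
          congr 1; abel
      _ ≤ 2 * m * (‖x‖ + ‖y‖) + r := (norm_add_le _ _).trans
          (add_le_add (couplingGrad_snd_le P c x y) hy.le)
      _ ≤ _ := by gcongr
  have hpos : 0 ≤ 2 * m * (8 * r / η) + r := by positivity
  have hpos' : 0 ≤ 8 * r / η := by positivity
  have hzn : ∀ x p : E, ‖x‖ ≤ 8 * r / η → ‖p‖ ≤ 2 * m * (8 * r / η) + r →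
      ‖x + t • p‖ < min δ ρ ∧ ‖p‖ < δ := by
    intro x p hx hp
    have h1 : ‖x + t • p‖ ≤ 8 * r / η + t * (2 * m * (8 * r / η) + r) := by
      refine (norm_add_le _ _).trans (add_le_add hx ?_)
      rw [norm_smul, Real.norm_of_nonneg ht0.le]; gcongr
    constructor
    · linarith
    · have : 0 ≤ t * (2 * m * (8 * r / η) + r) := by positivity
      linarith [min_le_left δ ρ]
  obtain ⟨hzx, hpx⟩ := hzn x (p₁ x) (by linarith [norm_nonneg y]) hp₁
  obtain ⟨hzy, hpy⟩ := hzn y (p₂ y) (by linarith [norm_nonneg x]) hp₂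
  have hnear : ∀ z : E, ‖z‖ < min δ ρ → ∀ᶠ k in 𝓝 (0 : E), z + k ∈ closedBall (0 : E) ρ := by
    intro z hz
    have : Tendsto (fun k => z + k) (𝓝 (0 : E)) (𝓝 z) := by
      simpa using (continuous_const_add z).tendsto 0
    exact this (closedBall_mem_nhds_of_mem (by
      rw [mem_ball_zero_iff]; exact hz.trans_le (min_le_right _ _)))
  refine ⟨x + t • p₁ x, y + t • p₂ y, p₁ x, p₂ y, fderiv ℝ p₁ x, fderiv ℝ p₂ y,
    hzx.trans_le (min_le_left _ _), hzy.trans_le (min_le_left _ _), hpx, hpy, ?_, ?_, fun h k => ?_⟩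
  · filter_upwards [hnear _ hzx, eventually_taylor_two quad₁ hD₁.hasFDerivAt hδ] with k hk hk'
    linarith [ht₁ k hk, (abs_le.1 hk').2]
  · filter_upwards [hnear _ hzy, eventually_taylor_two quad₂ hD₂.hasFDerivAt hδ] with k hk hk'
    linarith [ht₂ k hk, (abs_le.1 hk').2]
  · rw [← sub_nonpos]
    refine nonpos_of_forall_eventually_le (b := ‖h‖ ^ 2 + ‖k‖ ^ 2) fun ε hε => ?_
    have hsm : ∀ h : E, Tendsto (fun s : ℝ => s • h) (𝓝 0) (𝓝 0) := fun h => by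
      simpa using (by fun_prop : Continuous fun s : ℝ => s • h).tendsto 0
    filter_upwards [(hsm h).eventually (eventually_taylor_two quad₁ hD₁.hasFDerivAt hε),
      (hsm k).eventually (eventually_taylor_two quad₂ hD₂.hasFDerivAt hε)] with s h1 h2
    have h3 := hmax (s • h) (s • k)
    rw [couplingForm_smul] at h3
    have h1' := (abs_le.1 h1).1
    have h2' := (abs_le.1 h2).1
    simp only [map_smul, inner_smul_left, inner_smul_right, norm_smul, mul_pow, Real.norm_eq_abs,
      sq_abs, RCLike.conj_to_real] at h1' h2' h3
    linarith

end TheoremOnSums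

section Pucci

variable {n : ℕ}

/-- The matrix of the bilinear form `⟨S x, y⟩` in the standard basis. -/
def formMatrix (S : Euc n →L[ℝ] Euc n) : Matrix (Fin n) (Fin n) ℝ :=
  fun i j => ⟪S (EuclideanSpace.single i 1), EuclideanSpace.single j 1⟫

lemma formMatrix_isSymm {S : Euc n →L[ℝ] Euc n} (hS : ∀ a b, ⟪S a, b⟫ = ⟪a, S b⟫) :
    (formMatrix S).IsSymm := by
  ext i j
  rw [Matrix.transpose_apply, formMatrix, formMatrix, hS, real_inner_comm]

lemma formMatrix_sub (S T : Euc n →L[ℝ] Euc n) :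
    formMatrix (S - T) = formMatrix S - formMatrix T := by
  ext i j
  simp only [formMatrix, Matrix.sub_apply, _root_.sub_apply, inner_sub_left]

lemma formMatrix_smul (c : ℝ) (S : Euc n →L[ℝ] Euc n) :
    formMatrix (c • S) = c • formMatrix S := by
  ext i j
  simp only [formMatrix, Matrix.smul_apply, _root_.smul_apply, inner_smul_left,
    RCLike.conj_to_real, smul_eq_mul]

lemma dotProduct_formMatrix_mulVec (S : Euc n →L[ℝ] Euc n) (x : Euc n) :
    x.ofLp ⬝ᵥ (formMatrix S).mulVec x.ofLp = ⟪S x, x⟫ := by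
  have hx : x = ∑ i, x i • (EuclideanSpace.single i (1 : ℝ) : Euc n) := by
    ext j
    simp [Finset.sum_apply, Pi.single_apply]
  conv_rhs => rw [hx]
  simp only [map_sum, map_smul, sum_inner, inner_sum, inner_smul_left, inner_smul_right,
    RCLike.conj_to_real, dotProduct, Matrix.mulVec, formMatrix, Finset.mul_sum]
  rw [Finset.sum_comm]
  refine Finset.sum_congr rfl fun i _ => Finset.sum_congr rfl fun j _ => ?_
  ring

lemma dotProduct_ofLp (x : Euc n) : x.ofLp ⬝ᵥ x.ofLp = ‖x‖ ^ 2 := by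
  rw [← real_inner_self_eq_norm_sq, EuclideanSpace.inner_eq_star_dotProduct]
  simp

lemma le_trace_mul_of_mem_EllMat {lam Lam ℓ : ℝ} (hlam : 0 < lam)
    {A M : Matrix (Fin n) (Fin n) ℝ} (hA : A ∈ EllMat n lam Lam) (hM : M.PosSemidef)
    {e : Fin n → ℝ} (he : e ⬝ᵥ e = 1) (hℓ : ℓ ≤ e ⬝ᵥ M.mulVec e) :
    lam * ℓ ≤ (A * M).trace := by
  obtain ⟨m, v, rfl⟩ := Matrix.posSemidef_iff_eq_sum_vecMulVec.1 hM
  have h1 : (A * ∑ i, vecMulVec (v i) (star (v i))).trace = ∑ i, v i ⬝ᵥ A.mulVec (v i) := by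
    rw [Finset.mul_sum, Matrix.trace_sum]
    refine Finset.sum_congr rfl fun i _ => ?_
    rw [Matrix.mul_vecMulVec, Matrix.trace_vecMulVec, star_trivial, dotProduct_comm]
  have h2 : e ⬝ᵥ (∑ i, vecMulVec (v i) (star (v i))).mulVec e = ∑ i, (v i ⬝ᵥ e) ^ 2 := by
    rw [Matrix.sum_mulVec, dotProduct_sum]
    refine Finset.sum_congr rfl fun i _ => ?_
    rw [Matrix.vecMulVec_mulVec, star_trivial, dotProduct_smul, dotProduct_comm e]
    simp [sq]
  rw [h2] at hℓ
  rw [h1]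
  have h3 : ∀ i, (v i ⬝ᵥ e) ^ 2 ≤ v i ⬝ᵥ v i := fun i => by
    have := Finset.sum_mul_sq_le_sq_mul_sq Finset.univ (v i) e
    simp only [dotProduct, ← sq] at he ⊢
    rwa [he, mul_one] at this
  calc lam * ℓ ≤ lam * ∑ i, (v i ⬝ᵥ e) ^ 2 := by gcongr
    _ ≤ lam * ∑ i, v i ⬝ᵥ v i := by gcongr with i; exact h3 i
    _ = ∑ i, lam * (v i ⬝ᵥ v i) := Finset.mul_sum _ _ _
    _ ≤ _ := Finset.sum_le_sum fun i _ => (hA.2 (v i)).1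

lemma trace_le_of_mem_EllMat {lam Lam : ℝ} {A : Matrix (Fin n) (Fin n) ℝ}
    (hA : A ∈ EllMat n lam Lam) : A.trace ≤ n * Lam := by
  have h : ∀ i, A i i ≤ Lam := fun i => by
    have := (hA.2 (Pi.single i 1)).2
    simpa using this
  calc A.trace ≤ ∑ _i : Fin n, Lam := Finset.sum_le_sum fun i _ => h i
    _ = n * Lam := by simp

lemma pucciSup_formMatrix_le {lam Lam : ℝ} (hlam : 0 < lam) (hlamLam : lam ≤ Lam)
    {S : Euc n →L[ℝ] Euc n} (hS : ∀ a b, ⟪S a, b⟫ = ⟪a, S b⟫) {c ℓ : ℝ} (hc : 0 ≤ c)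
    (hSc : ∀ x, ⟪S x, x⟫ ≤ c * ‖x‖ ^ 2) {e : Euc n} (he : ‖e‖ = 1) (hℓ : ⟪S e, e⟫ ≤ c - ℓ) :
    pucciSup n lam Lam (formMatrix S) ≤ c * (n * Lam) - lam * ℓ := by
  refine csSup_le ⟨_, mem_image_of_mem _ (x := lam • (1 : Matrix (Fin n) (Fin n) ℝ)) ⟨?_, ?_⟩⟩ ?_
  · exact Matrix.IsSymm.smul Matrix.isSymm_one _
  · intro x
    have hx : 0 ≤ x ⬝ᵥ x := by
      simpa using dotProduct_star_self_nonneg x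
    simp only [Matrix.smul_mulVec, Matrix.one_mulVec, dotProduct_smul, smul_eq_mul]
    exact ⟨le_rfl, by gcongr⟩
  · rintro _ ⟨A, hA, rfl⟩
    have hquad : ∀ x : Euc n, x.ofLp ⬝ᵥ (c • (1 : Matrix (Fin n) (Fin n) ℝ)
        - formMatrix S).mulVec x.ofLp = c * ‖x‖ ^ 2 - ⟪S x, x⟫ := fun x => by
      rw [Matrix.sub_mulVec, dotProduct_sub, dotProduct_formMatrix_mulVec, Matrix.smul_mulVec,
        Matrix.one_mulVec, dotProduct_smul, dotProduct_ofLp, smul_eq_mul]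
    have hpsd : (c • (1 : Matrix (Fin n) (Fin n) ℝ) - formMatrix S).PosSemidef := by
      refine Matrix.PosSemidef.of_dotProduct_mulVec_nonneg ?_ fun x => ?_
      · rw [Matrix.IsHermitian, Matrix.conjTranspose_eq_transpose_of_trivial]
        exact (Matrix.isSymm_one.smul c).sub (formMatrix_isSymm hS)
      · have := hquad (WithLp.toLp 2 x)
        rw [star_trivial]
        simp only at this
        rw [this]
        linarith [hSc (WithLp.toLp 2 x)]
    have h1 := le_trace_mul_of_mem_EllMat (ℓ := ℓ) hlam hA hpsd (e := e.ofLp)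
      (by rw [dotProduct_ofLp, he, one_pow]) (by rw [hquad, he]; linarith)
    rw [Matrix.mul_sub, Matrix.trace_sub, Matrix.mul_smul, Matrix.mul_one, Matrix.trace_smul,
      smul_eq_mul] at h1
    have h2 := mul_le_mul_of_nonneg_left (trace_le_of_mem_EllMat hA) hc
    simp only
    linarith

end Pucci

section TestFunctions

variable {n : ℕ}

/-- A quadratic test function centred at `z`. -/
def quadTest (ξ b z : Euc n) (T : Euc n →L[ℝ] Euc n) (x : Euc n) : ℝ :=
  ⟪ξ, x⟫ + ⟪b, x - z⟫ + 1 / 2 * ⟪T (x - z), x - z⟫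

lemma contDiff_quadTest (ξ b z : Euc n) (T : Euc n →L[ℝ] Euc n) :
    ContDiff ℝ 2 (quadTest ξ b z T) := by
  unfold quadTest
  have h1 : ContDiff ℝ 2 fun x : Euc n => x - z := contDiff_id.sub contDiff_const
  have h2 : ContDiff ℝ 2 fun x : Euc n => T (x - z) := T.contDiff.comp h1
  exact ((contDiff_const.inner ℝ contDiff_id).add (contDiff_const.inner ℝ h1)).add
    (contDiff_const.mul (h2.inner ℝ h1))

lemma hasFDerivAt_quadTest {T : Euc n →L[ℝ] Euc n} (hT : ∀ a b, ⟪T a, b⟫ = ⟪a, T b⟫)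
    (ξ b z x : Euc n) :
    HasFDerivAt (quadTest ξ b z T) (innerSL ℝ (ξ + b + T (x - z))) x := by
  refine hasFDerivAt_of_quadratic_bound (c := ‖T‖) fun k => ?_
  have e : quadTest ξ b z T (x + k) - quadTest ξ b z T x - ⟪ξ + b + T (x - z), k⟫
      = 1 / 2 * ⟪T k, k⟫ := by
    have h1 : ⟪T k, x - z⟫ = ⟪T (x - z), k⟫ := by rw [hT, real_inner_comm]
    rw [quadTest, quadTest, show x + k - z = (x - z) + k by abel]
    simp only [map_add, inner_add_left, inner_add_right, h1]
    ring
  rw [e, abs_mul, abs_of_pos (by norm_num : (0 : ℝ) < 1 / 2)]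
  have : |⟪T k, k⟫| ≤ ‖T‖ * ‖k‖ ^ 2 := by
    calc |⟪T k, k⟫| ≤ ‖T k‖ * ‖k‖ := abs_real_inner_le_norm _ _
      _ ≤ (‖T‖ * ‖k‖) * ‖k‖ := by gcongr; exact T.le_opNorm k
      _ = _ := by ring
  linarith [abs_nonneg ⟪T k, k⟫]

lemma gradient_quadTest {T : Euc n →L[ℝ] Euc n} (hT : ∀ a b, ⟪T a, b⟫ = ⟪a, T b⟫)
    (ξ b z : Euc n) : gradient (quadTest ξ b z T) z = ξ + b := by
  have h := hasFDerivAt_quadTest hT ξ b z z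
  rw [sub_self, map_zero, add_zero] at h
  exact HasGradientAt.gradient (hasGradientAt_iff_hasFDerivAt.2 h)

lemma hess_quadTest {T : Euc n →L[ℝ] Euc n} (hT : ∀ a b, ⟪T a, b⟫ = ⟪a, T b⟫)
    (ξ b z : Euc n) : hess (quadTest ξ b z T) z = formMatrix T := by
  have h1 : fderiv ℝ (quadTest ξ b z T) = fun x => innerSL ℝ (ξ + b + T (x - z)) :=
    funext fun x => (hasFDerivAt_quadTest hT ξ b z x).fderiv
  have h2 : HasFDerivAt (fun x => innerSL ℝ (ξ + b + T (x - z))) ((innerSL ℝ).comp T) z := by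
    have h3 : HasFDerivAt (fun x => ξ + b + T (x - z)) T z := by
      have h0 : HasFDerivAt (fun x => x - z) (ContinuousLinearMap.id ℝ (Euc n)) z :=
        (hasFDerivAt_id z).sub_const z
      have h4 : HasFDerivAt (fun x => T (x - z)) (T.comp (ContinuousLinearMap.id ℝ (Euc n))) z :=
        T.hasFDerivAt.comp (f := fun x => x - z) z h0
      exact h4.const_add (ξ + b)
    exact (innerSL ℝ (E := Euc n)).hasFDerivAt.comp z h3
  ext i j
  rw [hess, iteratedFDeriv_two_apply, h1, h2.fderiv]
  simp [formMatrix]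

variable {F : Matrix (Fin n) (Fin n) ℝ → ℝ} {κ q ϑ μ : ℝ} {ξ : Euc n} {u f : Euc n → ℝ}

lemma mainG_quadTest (hϑ : 0 < ϑ) {S : Euc n →L[ℝ] Euc n} (hS : ∀ a b, ⟪S a, b⟫ = ⟪a, S b⟫)
    (a z : Euc n) :
    mainG κ q (fun M => ϑ * F (ϑ⁻¹ • M)) (gradient (quadTest ξ (ϑ • a) z (ϑ • S)) z)
      (hess (quadTest ξ (ϑ • a) z (ϑ • S)) z) =
    max (‖ξ + ϑ • a‖ - κ) 0 ^ q * (ϑ * F (formMatrix S)) := by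
  have hT : ∀ a b, ⟪(ϑ • S) a, b⟫ = ⟪a, (ϑ • S) b⟫ := fun a b => by
    simp only [_root_.smul_apply, inner_smul_left, inner_smul_right, RCLike.conj_to_real, hS]
  rw [gradient_quadTest hT, hess_quadTest hT, formMatrix_smul, mainG, smul_smul,
    inv_mul_cancel₀ hϑ.ne', one_smul]

lemma quadTest_add (a z k : Euc n) (S : Euc n →L[ℝ] Euc n) :
    quadTest ξ (ϑ • a) z (ϑ • S) (z + k) =
      ⟪ξ, z + k⟫ + ϑ * (⟪a, k⟫ + 1 / 2 * ⟪S k, k⟫) := by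
  simp only [quadTest, add_sub_cancel_left, _root_.smul_apply, inner_smul_left,
    RCLike.conj_to_real]
  ring

lemma quadTest_self (a z : Euc n) (S : Euc n →L[ℝ] Euc n) :
    quadTest ξ (ϑ • a) z (ϑ • S) z = ⟪ξ, z⟫ := by
  simpa using quadTest_add (ξ := ξ) (ϑ := ϑ) a z 0 S

lemma eventually_translate {z : Euc n} {p : Euc n → Prop} (h : ∀ᶠ k in 𝓝 0, p (z + k)) :
    ∀ᶠ x in 𝓝 z, p x := by
  have : Tendsto (fun x => x - z) (𝓝 z) (𝓝 0) := by
    simpa using (continuous_sub_right z).tendsto z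
  filter_upwards [this.eventually h] with x hx
  simpa using hx

lemma rpow_neg_mul_bound (hμ : 0 < μ) (hq : 0 ≤ q) {m : ℝ} (hm : μ ≤ m) :
    1 ≤ m ^ q * μ ^ (-q) := by
  rw [Real.rpow_neg hμ.le, ← div_eq_mul_inv, one_le_div (Real.rpow_pos_of_pos hμ q)]
  exact Real.rpow_le_rpow hμ.le hm hq

/-- A paraboloid touching `u` from above has Hessian on which `F` is bounded below. -/
lemma GradSubSol.neg_rpow_le (hq : 0 ≤ q) (hϑ : 0 < ϑ) (hμ : 0 < μ)
    (hf : ∀ x ∈ ball (0 : Euc n) 1, |f x| ≤ 1)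
    (hsub : GradSubSol κ (mainG κ q (fun M => ϑ * F (ϑ⁻¹ • M))) (fun x => ϑ * f x)
      (ball 0 1) (fun x => ⟪ξ, x⟫ + ϑ * u x))
    {z a : Euc n} (hz : z ∈ ball (0 : Euc n) 1) {S : Euc n →L[ℝ] Euc n}
    (hS : ∀ a b, ⟪S a, b⟫ = ⟪a, S b⟫) (ha : κ + μ ≤ ‖ξ + ϑ • a‖)
    (htouch : ∀ᶠ k in 𝓝 (0 : Euc n), u (z + k) ≤ u z + ⟪a, k⟫ + 1 / 2 * ⟪S k, k⟫) :
    -μ ^ (-q) ≤ F (formMatrix S) := by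
  have hT : ∀ a b, ⟪(ϑ • S) a, b⟫ = ⟪a, (ϑ • S) b⟫ := fun a b => by
    simp only [_root_.smul_apply, inner_smul_left, inner_smul_right, RCLike.conj_to_real, hS]
  have h := hsub z hz _ (contDiff_quadTest ξ (ϑ • a) z (ϑ • S))
    (eventually_translate (by
      filter_upwards [htouch] with k hk
      rw [quadTest_add, quadTest_self]
      have := mul_le_mul_of_nonneg_left hk hϑ.le
      linarith))
    (by rw [gradient_quadTest hT]; linarith)
  rw [mainG_quadTest hϑ hS] at h
  have hm : μ ≤ max (‖ξ + ϑ • a‖ - κ) 0 := le_max_of_le_left (by linarith)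
  set m := max (‖ξ + ϑ • a‖ - κ) 0
  have hf1 := (abs_le.1 (hf z hz)).1
  have h1 : f z ≤ m ^ q * F (formMatrix S) := by
    refine le_of_mul_le_mul_left ?_ hϑ
    linarith
  have h2 := rpow_neg_mul_bound hμ hq hm
  have hmq : 0 < m ^ q := Real.rpow_pos_of_pos (hμ.trans_le hm) q
  refine le_of_mul_le_mul_left ?_ hmq
  linarith

/-- A paraboloid touching `u` from below has Hessian on which `F` is bounded above. -/
lemma GradSupSol.le_rpow (hq : 0 ≤ q) (hϑ : 0 < ϑ) (hμ : 0 < μ)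
    (hf : ∀ x ∈ ball (0 : Euc n) 1, |f x| ≤ 1)
    (hsup : GradSupSol κ (mainG κ q (fun M => ϑ * F (ϑ⁻¹ • M))) (fun x => ϑ * f x)
      (ball 0 1) (fun x => ⟪ξ, x⟫ + ϑ * u x))
    {z a : Euc n} (hz : z ∈ ball (0 : Euc n) 1) {S : Euc n →L[ℝ] Euc n}
    (hS : ∀ a b, ⟪S a, b⟫ = ⟪a, S b⟫) (ha : κ + μ ≤ ‖ξ + ϑ • a‖)
    (htouch : ∀ᶠ k in 𝓝 (0 : Euc n), u z + ⟪a, k⟫ + 1 / 2 * ⟪S k, k⟫ ≤ u (z + k)) :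
    F (formMatrix S) ≤ μ ^ (-q) := by
  have hT : ∀ a b, ⟪(ϑ • S) a, b⟫ = ⟪a, (ϑ • S) b⟫ := fun a b => by
    simp only [_root_.smul_apply, inner_smul_left, inner_smul_right, RCLike.conj_to_real, hS]
  have h := hsup z hz _ (contDiff_quadTest ξ (ϑ • a) z (ϑ • S))
    (eventually_translate (by
      filter_upwards [htouch] with k hk
      rw [quadTest_add, quadTest_self]
      have := mul_le_mul_of_nonneg_left hk hϑ.le
      linarith))
    (by rw [gradient_quadTest hT]; linarith)
  rw [mainG_quadTest hϑ hS] at h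
  have hm : μ ≤ max (‖ξ + ϑ • a‖ - κ) 0 := le_max_of_le_left (by linarith)
  set m := max (‖ξ + ϑ • a‖ - κ) 0
  have hf1 := (abs_le.1 (hf z hz)).2
  have h1 : m ^ q * F (formMatrix S) ≤ f z := by
    refine le_of_mul_le_mul_left ?_ hϑ
    linarith
  have h2 := rpow_neg_mul_bound hμ hq hm
  have hmq : 0 < m ^ q := Real.rpow_pos_of_pos (hμ.trans_le hm) q
  refine le_of_mul_le_mul_left ?_ hmq
  linarith

end TestFunctions

section Doubling

variable {E : Type*} [NormedAddCommGroup E] [InnerProductSpace ℝ E]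

/-- Second order upper bound for the norm away from the origin. -/
lemma norm_add_le_quadratic {d w : E} (hd : d ≠ 0) (hw : ‖w‖ ≤ ‖d‖ / 2) :
    ‖d + w‖ ≤ ‖d‖ + ⟪‖d‖⁻¹ • d, w⟫ + ‖d‖⁻¹ * (‖w‖ ^ 2 - ⟪‖d‖⁻¹ • d, w⟫ ^ 2) := by
  have hr : 0 < ‖d‖ := norm_pos_iff.2 hd
  have he : ‖‖d‖⁻¹ • d‖ = 1 := by
    rw [norm_smul, norm_inv, norm_norm, inv_mul_cancel₀ hr.ne']
  have hsw : |⟪‖d‖⁻¹ • d, w⟫| ≤ ‖w‖ := by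
    simpa [he] using abs_real_inner_le_norm (‖d‖⁻¹ • d) w
  have hdw : ⟪d, w⟫ = ‖d‖ * ⟪‖d‖⁻¹ • d, w⟫ := by
    rw [inner_smul_left, RCLike.conj_to_real, mul_inv_cancel_left₀ hr.ne']
  have hsq : ‖d + w‖ ^ 2 = ‖d‖ ^ 2 + 2 * ⟪d, w⟫ + ‖w‖ ^ 2 := norm_add_sq_real d w
  rw [hdw] at hsq
  set s := ⟪‖d‖⁻¹ • d, w⟫
  set r := ‖d‖
  have h1 : 0 ≤ ‖w‖ ^ 2 - s ^ 2 := by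
    rw [sub_nonneg, ← sq_abs s]; gcongr
  have hs : -(r / 2) ≤ s := by linarith [(abs_le.1 hsw).1]
  set t := r⁻¹ * (‖w‖ ^ 2 - s ^ 2) with ht
  have ht0 : 0 ≤ t := by positivity
  have hrt : r * t = ‖w‖ ^ 2 - s ^ 2 := by rw [ht, mul_inv_cancel_left₀ hr.ne']
  refine le_of_sq_le_sq ?_ (by linarith)
  nlinarith [mul_nonneg ht0 (by linarith : 0 ≤ r + 2 * s), sq_nonneg t]

/-- The Hessian bound of the profile `L (‖d‖ - ‖d‖² / 8)`. -/
def profileForm (L : ℝ) (d : E) : E →L[ℝ] E :=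
  L • (‖d‖⁻¹ • (ContinuousLinearMap.id ℝ E - (innerSL ℝ (‖d‖⁻¹ • d)).smulRight (‖d‖⁻¹ • d))
    - (1 / 8 : ℝ) • ContinuousLinearMap.id ℝ E)

lemma profileForm_inner (L : ℝ) (d a b : E) :
    ⟪profileForm L d a, b⟫ =
      L * (‖d‖⁻¹ * (⟪a, b⟫ - ⟪‖d‖⁻¹ • d, a⟫ * ⟪‖d‖⁻¹ • d, b⟫) - ⟪a, b⟫ / 8) := by
  set e := ‖d‖⁻¹ • d with he
  simp only [profileForm, ← he, _root_.smul_apply, _root_.sub_apply, ContinuousLinearMap.id_apply,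
    ContinuousLinearMap.smulRight_apply, innerSL_apply_apply, inner_smul_left, inner_sub_left,
    RCLike.conj_to_real]
  ring

lemma profileForm_symm (L : ℝ) (d a b : E) :
    ⟪profileForm L d a, b⟫ = ⟪a, profileForm L d b⟫ := by
  rw [real_inner_comm _ a, profileForm_inner, profileForm_inner, real_inner_comm a b]
  ring

lemma profile_add_le {L : ℝ} (hL : 0 ≤ L) {d w : E} (hd : d ≠ 0) (hw : ‖w‖ ≤ ‖d‖ / 2) :
    L * (‖d + w‖ - ‖d + w‖ ^ 2 / 8) ≤ L * (‖d‖ - ‖d‖ ^ 2 / 8)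
      + ⟪(L * (‖d‖⁻¹ - 1 / 4)) • d, w⟫ + ⟪profileForm L d w, w⟫ := by
  have h1 := norm_add_le_quadratic hd hw
  have hsq : ‖d + w‖ ^ 2 = ‖d‖ ^ 2 + 2 * ⟪d, w⟫ + ‖w‖ ^ 2 := norm_add_sq_real d w
  have h2 : ⟪(L * (‖d‖⁻¹ - 1 / 4)) • d, w⟫ = L * (⟪‖d‖⁻¹ • d, w⟫ - ⟪d, w⟫ / 4) := by
    simp only [inner_smul_left, RCLike.conj_to_real]; ring
  rw [h2, profileForm_inner, real_inner_self_eq_norm_sq, ← mul_add, ← mul_add]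
  refine mul_le_mul_of_nonneg_left ?_ hL
  rw [hsq]
  linarith

variable [FiniteDimensional ℝ E]

lemma exists_symm_inner_self (D : E →L[ℝ] E) (c : ℝ) :
    ∃ S : E →L[ℝ] E, (∀ a b, ⟪S a, b⟫ = ⟪a, S b⟫) ∧ ∀ x, ⟪S x, x⟫ = ⟪D x, x⟫ + c * ‖x‖ ^ 2 := by
  have : CompleteSpace E := FiniteDimensional.complete ℝ E
  refine ⟨(1 / 2 : ℝ) • (D + ContinuousLinearMap.adjoint D) + c • ContinuousLinearMap.id ℝ E,
    fun a b => ?_, fun x => ?_⟩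
  · simp only [_root_.add_apply, _root_.smul_apply, ContinuousLinearMap.id_apply, inner_add_left,
      inner_add_right, inner_smul_left, inner_smul_right, RCLike.conj_to_real,
      ContinuousLinearMap.adjoint_inner_left, ContinuousLinearMap.adjoint_inner_right]
    ring
  · simp only [_root_.add_apply, _root_.smul_apply, ContinuousLinearMap.id_apply, inner_add_left,
      inner_smul_left, RCLike.conj_to_real, ContinuousLinearMap.adjoint_inner_left,
      real_inner_self_eq_norm_sq]
    rw [real_inner_comm x (D x)]
    ring

/-- Touching paraboloids produced by an interior maximum of the doubled function. -/
lemma exists_touching_of_doubling_max {u : E → ℝ} {L ρ : ℝ} {x₀ x y : E} (hL : 0 ≤ L)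
    (hρ : 0 < ρ) (hxy : x ≠ y) (hρd : ρ ≤ ‖x - y‖ / 4) (hd : ‖x - y‖ ≤ 4)
    (hx : ‖x - x₀‖ ≤ 1 / 4) (hy : ‖y - x₀‖ ≤ 1 / 4)
    (hux : ContinuousOn u (closedBall x ρ)) (huy : ContinuousOn u (closedBall y ρ))
    (hmax : ∀ x' ∈ closedBall x ρ, ∀ y' ∈ closedBall y ρ,
      u x' - u y' - L * (‖x' - y'‖ - ‖x' - y'‖ ^ 2 / 8) - 64 * (‖x' - x₀‖ ^ 2 + ‖y' - x₀‖ ^ 2) ≤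
      u x - u y - L * (‖x - y‖ - ‖x - y‖ ^ 2 / 8) - 64 * (‖x - x₀‖ ^ 2 + ‖y - x₀‖ ^ 2)) :
    ∃ (z w a b e : E) (S T : E →L[ℝ] E), z ∈ closedBall x ρ ∧ w ∈ closedBall y ρ ∧
      ‖a‖ ≤ L + 33 ∧ ‖b‖ ≤ L + 33 ∧ ‖e‖ = 1 ∧
      (∀ a b, ⟪S a, b⟫ = ⟪a, S b⟫) ∧ (∀ a b, ⟪T a, b⟫ = ⟪a, T b⟫) ∧
      (∀ᶠ k in 𝓝 0, u (z + k) ≤ u z + ⟪a, k⟫ + 1 / 2 * ⟪S k, k⟫) ∧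
      (∀ᶠ k in 𝓝 0, u w + ⟪b, k⟫ + 1 / 2 * ⟪T k, k⟫ ≤ u (w + k)) ∧
      (∀ h, ⟪(S - T) h, h⟫ ≤ 262 * ‖h‖ ^ 2) ∧ ⟪(S - T) e, e⟫ ≤ 262 - L := by
  set d := x - y with hd_def
  have hd0 : d ≠ 0 := sub_ne_zero.2 hxy
  have hr : 0 < ‖d‖ := norm_pos_iff.2 hd0
  set p := (L * (‖d‖⁻¹ - 1 / 4)) • d with hp_def
  have hp : ‖p‖ ≤ L := by
    have h1 : 0 ≤ ‖d‖⁻¹ - 1 / 4 := by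
      rw [sub_nonneg, one_div]; exact inv_anti₀ hr hd
    rw [hp_def, norm_smul, Real.norm_of_nonneg (by positivity), mul_assoc]
    have h2 : (‖d‖⁻¹ - 1 / 4) * ‖d‖ ≤ 1 := by
      rw [sub_mul, inv_mul_cancel₀ hr.ne']; linarith
    nlinarith
  set α₁ := p + (128 : ℝ) • (x - x₀) with hα₁
  set α₂ := -p + (128 : ℝ) • (y - x₀) with hα₂
  have hα₁n : ‖α₁‖ ≤ L + 32 := by
    refine (norm_add_le _ _).trans ?_
    rw [norm_smul (128 : ℝ), Real.norm_of_nonneg (by norm_num)]; linarith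
  have hα₂n : ‖α₂‖ ≤ L + 32 := by
    refine (norm_add_le _ _).trans ?_
    rw [norm_smul (128 : ℝ), norm_neg, Real.norm_of_nonneg (by norm_num)]; linarith
  have hmem : ∀ c : E, ∀ h ∈ closedBall (0 : E) ρ, c + h ∈ closedBall c ρ := fun c h hh => by
    rw [mem_closedBall_iff_norm] at hh ⊢
    simpa using hh
  set g₁ : E → ℝ := fun h => u (x + h) - u x - ⟪α₁, h⟫ with hg₁
  set g₂ : E → ℝ := fun k => u y - u (y + k) - ⟪α₂, k⟫ with hg₂
  have hc₁ : ContinuousOn g₁ (closedBall 0 ρ) :=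
    ((hux.comp (by fun_prop) (hmem x)).sub continuousOn_const).sub (by fun_prop)
  have hc₂ : ContinuousOn g₂ (closedBall 0 ρ) :=
    (continuousOn_const.sub (huy.comp (by fun_prop) (hmem y))).sub (by fun_prop)
  have hle : ∀ h ∈ closedBall (0 : E) ρ, ∀ k ∈ closedBall (0 : E) ρ,
      g₁ h + g₂ k ≤ couplingForm (profileForm L d) 65 h k - 1 * (‖h‖ ^ 2 + ‖k‖ ^ 2) := by
    intro h hh k hk
    have h1 := hmax _ (hmem x h hh) _ (hmem y k hk)
    rw [mem_closedBall_zero_iff] at hh hk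
    have h2 : ‖h - k‖ ≤ ‖d‖ / 2 := (norm_sub_le h k).trans (by linarith)
    have h3 := profile_add_le hL hd0 h2
    have e1 : x + h - (y + k) = d + (h - k) := by rw [hd_def]; abel
    have e2 : ‖x + h - x₀‖ ^ 2 = ‖x - x₀‖ ^ 2 + 2 * ⟪x - x₀, h⟫ + ‖h‖ ^ 2 := by
      rw [← norm_add_sq_real]; congr 2; abel
    have e3 : ‖y + k - x₀‖ ^ 2 = ‖y - x₀‖ ^ 2 + 2 * ⟪y - x₀, k⟫ + ‖k‖ ^ 2 := by
      rw [← norm_add_sq_real]; congr 2; abel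
    have e4 : ⟪p, h - k⟫ = ⟪p, h⟫ - ⟪p, k⟫ := inner_sub_right _ _ _
    have e5 : ⟪α₁, h⟫ = ⟪p, h⟫ + 128 * ⟪x - x₀, h⟫ := by
      rw [hα₁, inner_add_left, real_inner_smul_left (x - x₀)]
    have e6 : ⟪α₂, k⟫ = -⟪p, k⟫ + 128 * ⟪y - x₀, k⟫ := by
      rw [hα₂, inner_add_left, inner_neg_left, real_inner_smul_left (y - x₀)]
    rw [e1, e2, e3] at h1
    rw [← hp_def, e4] at h3
    simp only [hg₁, hg₂, couplingForm, e5, e6]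
    linarith
  have h00 : 0 ≤ g₁ 0 + g₂ 0 := by simp [hg₁, hg₂]
  obtain ⟨z₁, z₂, a₁, a₂, D₁, D₂, hz₁, hz₂, ha₁, ha₂, ht₁, ht₂, hD⟩ :=
    theorem_on_sums (profileForm_symm L d) one_pos hρ hc₁ hc₂ h00 hle
      (δ := min (1 / 2) ρ) (by positivity)
  have hδ : min (1 / 2) ρ ≤ 1 / 2 := min_le_left _ _
  have hδρ : min (1 / 2) ρ ≤ ρ := min_le_right _ _
  obtain ⟨S, hS, hSD⟩ := exists_symm_inner_self D₁ 1
  obtain ⟨T, hT, hTD⟩ := exists_symm_inner_self (-D₂) (-1)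
  have hST : ∀ h, ⟪(S - T) h, h⟫ = ⟪D₁ h, h⟫ + ⟪D₂ h, h⟫ + 2 * ‖h‖ ^ 2 := fun h => by
    rw [_root_.sub_apply, inner_sub_left, hSD, hTD, _root_.neg_apply, inner_neg_left]; ring
  have he : ‖‖d‖⁻¹ • d‖ = 1 := by
    rw [norm_smul, norm_inv, norm_norm, inv_mul_cancel₀ hr.ne']
  refine ⟨x + z₁, y + z₂, α₁ + a₁, -(α₂ + a₂), ‖d‖⁻¹ • d, S, T,
    hmem x z₁ (by rw [mem_closedBall_zero_iff]; linarith),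
    hmem y z₂ (by rw [mem_closedBall_zero_iff]; linarith),
    (norm_add_le _ _).trans (by linarith), ?_, he, hS, hT, ?_, ?_, fun h => ?_, ?_⟩
  · rw [norm_neg]
    exact (norm_add_le _ _).trans (by linarith)
  · filter_upwards [ht₁] with k hk
    simp only [hg₁, inner_add_right, ← add_assoc] at hk
    rw [hSD, inner_add_left]
    have := mul_le_mul_of_nonneg_right hδ (sq_nonneg ‖k‖)
    linarith
  · filter_upwards [ht₂] with k hk
    simp only [hg₂, inner_add_right, ← add_assoc] at hk
    rw [hTD, inner_neg_left, inner_add_left, _root_.neg_apply, inner_neg_left]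
    have := mul_le_mul_of_nonneg_right hδ (sq_nonneg ‖k‖)
    linarith
  · have := hD h h
    simp only [couplingForm, sub_self, map_zero, inner_zero_left] at this
    rw [hST]
    linarith
  · have := hD (‖d‖⁻¹ • d) (-(‖d‖⁻¹ • d))
    have e1 : ‖d‖⁻¹ • d - -(‖d‖⁻¹ • d) = (2 : ℝ) • (‖d‖⁻¹ • d) := by rw [two_smul]; abel
    have e2 : ⟪‖d‖⁻¹ • d, (2 : ℝ) • ‖d‖⁻¹ • d⟫ = 2 := by
      rw [real_inner_smul_right _ (‖d‖⁻¹ • d), real_inner_self_eq_norm_sq, he]; norm_num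
    rw [couplingForm, e1, profileForm_inner, e2, real_inner_self_eq_norm_sq,
      norm_smul (2 : ℝ), norm_neg, he, map_neg, inner_neg_neg] at this
    rw [hST, he]
    norm_num at this ⊢
    linarith

end Doubling

section Lipschitz

variable {n : ℕ} {lam Lam κ q ϑ μ : ℝ} {F : Matrix (Fin n) (Fin n) ℝ → ℝ} {ξ : Euc n}
  {u f : Euc n → ℝ}

lemma le_norm_add_smul {E : Type*} [NormedAddCommGroup E] [NormedSpace ℝ E] {ξ a : E}
    {κ ϑ μ : ℝ} (hϑ : 0 ≤ ϑ) (hξ : κ + 2 * μ ≤ ‖ξ‖) (ha : ϑ * ‖a‖ ≤ μ) : κ + μ ≤ ‖ξ + ϑ • a‖ := by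
  have h1 : ‖ξ‖ ≤ ‖ξ + ϑ • a‖ + ‖ϑ • a‖ := by
    simpa using norm_sub_le (ξ + ϑ • a) (ϑ • a)
  rw [norm_smul, Real.norm_of_nonneg hϑ] at h1
  linarith

/-- Ishii–Lions estimate at a point `x₀` of the half ball. -/
lemma GradSol.sub_le_profile (hlam : 0 < lam) (hlamLam : lam ≤ Lam)
    (hF : IsUniformlyElliptic n lam Lam F) (hq : 0 ≤ q) (hϑ : 0 < ϑ) (hμ : 0 < μ)
    (hu : ∀ x ∈ ball (0 : Euc n) 1, |u x| ≤ 1) (hf : ∀ x ∈ ball (0 : Euc n) 1, |f x| ≤ 1)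
    (huc : ContinuousOn u (ball 0 1))
    (hsol : GradSol κ (mainG κ q (fun M => ϑ * F (ϑ⁻¹ • M))) (fun x => ϑ * f x)
      (ball 0 1) (fun x => ⟪ξ, x⟫ + ϑ * u x))
    (hξ : κ + 2 * μ ≤ ‖ξ‖) {L : ℝ} (hL0 : 0 ≤ L)
    (hL : 262 * (n * Lam) + 2 * μ ^ (-q) < lam * L) (hϑL : ϑ * (L + 33) ≤ μ)
    {x₀ : Euc n} (hx₀ : x₀ ∈ ball (0 : Euc n) (1 / 2)) :
    ∀ x ∈ closedBall x₀ (1 / 4), ∀ y ∈ closedBall x₀ (1 / 4),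
      u x - u y ≤ L * (‖x - y‖ - ‖x - y‖ ^ 2 / 8) + 64 * (‖x - x₀‖ ^ 2 + ‖y - x₀‖ ^ 2) := by
  have hB : closedBall x₀ (1 / 4) ⊆ ball (0 : Euc n) 1 := by
    intro x hx
    rw [mem_ball, dist_zero_right] at hx₀ ⊢
    rw [mem_closedBall_iff_norm] at hx
    have : ‖x‖ ≤ ‖x - x₀‖ + ‖x₀‖ := by simpa using norm_add_le (x - x₀) x₀
    linarith
  set Φ : Euc n × Euc n → ℝ := fun ζ => u ζ.1 - u ζ.2
    - L * (‖ζ.1 - ζ.2‖ - ‖ζ.1 - ζ.2‖ ^ 2 / 8) - 64 * (‖ζ.1 - x₀‖ ^ 2 + ‖ζ.2 - x₀‖ ^ 2) with hΦ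
  have hucB := huc.mono hB
  have hΦc : ContinuousOn Φ (closedBall x₀ (1 / 4) ×ˢ closedBall x₀ (1 / 4)) := by
    have h1 : ContinuousOn (fun ζ : Euc n × Euc n => u ζ.1)
        (closedBall x₀ (1 / 4) ×ˢ closedBall x₀ (1 / 4)) :=
      hucB.comp continuousOn_fst fun ζ hζ => hζ.1
    have h2 : ContinuousOn (fun ζ : Euc n × Euc n => u ζ.2)
        (closedBall x₀ (1 / 4) ×ˢ closedBall x₀ (1 / 4)) :=
      hucB.comp continuousOn_snd fun ζ hζ => hζ.2
    exact ((h1.sub h2).sub (by fun_prop)).sub (by fun_prop)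
  have hx₀B : x₀ ∈ closedBall x₀ (1 / 4) := mem_closedBall_self (by norm_num)
  obtain ⟨⟨x, y⟩, ⟨hxB, hyB⟩, hmax⟩ := ((isCompact_closedBall x₀ (1 / 4)).prod
    (isCompact_closedBall x₀ (1 / 4))).exists_isMaxOn ⟨(x₀, x₀), hx₀B, hx₀B⟩ hΦc
  rw [isMaxOn_iff] at hmax
  simp only at hxB hyB
  suffices h : Φ (x, y) ≤ 0 by
    intro x' hx' y' hy'
    have := (hmax (x', y') ⟨hx', hy'⟩).trans h
    simp only [hΦ] at this
    linarith
  by_contra! hpos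
  simp only [hΦ] at hpos
  have hux := abs_le.1 (hu x (hB hxB))
  have huy := abs_le.1 (hu y (hB hyB))
  have hxn := mem_closedBall_iff_norm.1 hxB
  have hyn := mem_closedBall_iff_norm.1 hyB
  have hxy : x ≠ y := by
    rintro rfl
    simp only [sub_self, norm_zero] at hpos
    nlinarith [sq_nonneg ‖x - x₀‖]
  have hr : 0 < ‖x - y‖ := norm_pos_iff.2 (sub_ne_zero.2 hxy)
  have hr4 : ‖x - y‖ ≤ 4 := by
    have : ‖x - y‖ ≤ ‖x - x₀‖ + ‖y - x₀‖ := by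
      simpa using norm_sub_le (x - x₀) (y - x₀)
    linarith
  have hprof : 0 ≤ L * (‖x - y‖ - ‖x - y‖ ^ 2 / 8) := mul_nonneg hL0 (by nlinarith)
  have hx4 : ‖x - x₀‖ < 1 / 4 := by nlinarith [sq_nonneg ‖y - x₀‖, norm_nonneg (x - x₀)]
  have hy4 : ‖y - x₀‖ < 1 / 4 := by nlinarith [sq_nonneg ‖x - x₀‖, norm_nonneg (y - x₀)]
  set ρ := min (‖x - y‖ / 4) (min (1 / 4 - ‖x - x₀‖) (1 / 4 - ‖y - x₀‖)) with hρ_def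
  have hρ : 0 < ρ := lt_min (by positivity) (lt_min (by linarith) (by linarith))
  have hρ1 : ρ ≤ ‖x - y‖ / 4 := min_le_left _ _
  have hρx : closedBall x ρ ⊆ closedBall x₀ (1 / 4) := closedBall_subset_closedBall' (by
    rw [dist_eq_norm]
    linarith [(min_le_right _ _ : ρ ≤ _), min_le_left (1 / 4 - ‖x - x₀‖) (1 / 4 - ‖y - x₀‖)])
  have hρy : closedBall y ρ ⊆ closedBall x₀ (1 / 4) := closedBall_subset_closedBall' (by
    rw [dist_eq_norm]
    linarith [(min_le_right _ _ : ρ ≤ _), min_le_right (1 / 4 - ‖x - x₀‖) (1 / 4 - ‖y - x₀‖)])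
  obtain ⟨z, w, a, b, e, S, T, hz, hw, ha, hb, he, hS, hT, htS, htT, hST, hSTe⟩ :=
    exists_touching_of_doubling_max hL0 hρ hxy hρ1 hr4 hxn hyn (hucB.mono hρx) (hucB.mono hρy)
      fun x' hx' y' hy' => hmax (x', y') ⟨hρx hx', hρy hy'⟩
  have hslope : ∀ a : Euc n, ‖a‖ ≤ L + 33 → κ + μ ≤ ‖ξ + ϑ • a‖ := fun a ha =>
    le_norm_add_smul hϑ.le hξ ((mul_le_mul_of_nonneg_left ha hϑ.le).trans hϑL)
  have h1 := hsol.1.neg_rpow_le hq hϑ hμ hf (hB (hρx hz)) hS (hslope a ha) htS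
  have h2 := hsol.2.le_rpow hq hϑ hμ hf (hB (hρy hw)) hT (hslope b hb) htT
  have h3 := (hF _ _ (formMatrix_isSymm hS) (formMatrix_isSymm hT)).2
  rw [← formMatrix_sub] at h3
  have hsymm : ∀ a b, ⟪(S - T) a, b⟫ = ⟪a, (S - T) b⟫ := fun a b => by
    rw [_root_.sub_apply, _root_.sub_apply, inner_sub_left, inner_sub_right, hS, hT]
  have h4 := pucciSup_formMatrix_le hlam hlamLam hsymm (by norm_num) hST he hSTe
  linarith

end Lipschitz

/-- Lemma 4.1, uniform Lipschitz estimate for the scaled PDE: the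
constant `C` depends only on `n, λ, Λ`. -/
theorem scaled_lipschitz_estimate
    (n : ℕ) (hn : 1 ≤ n) (lam Lam : ℝ) (hlam : 0 < lam) (hlamLam : lam ≤ Lam) :
    ∃ C > 0, ∀ F : Matrix (Fin n) (Fin n) ℝ → ℝ, IsUniformlyElliptic n lam Lam F →
      ∀ κ q ϑ μ : ℝ, 0 ≤ κ → 0 ≤ q → 0 < ϑ → μ ∈ Ioo (0 : ℝ) 1 →
      ∀ ξ : Euc n, ∀ u f : Euc n → ℝ,
        (∀ x ∈ ball (0 : Euc n) 1, |u x| ≤ 1) →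
        (∀ x ∈ ball (0 : Euc n) 1, |f x| ≤ 1) →
        ContinuousOn u (ball 0 1) → ContinuousOn f (ball 0 1) →
        GradSol κ (mainG κ q (fun M => ϑ * F (ϑ⁻¹ • M))) (fun x => ϑ * f x)
          (ball 0 1) (fun x => ⟪ξ, x⟫ + ϑ * u x) →
        κ + 2 * μ ≤ ‖ξ‖ → ϑ ≤ μ ^ (q + 1) / (2 * C) →
        ∀ x ∈ ball (0 : Euc n) (1/2), ∀ y ∈ ball (0 : Euc n) (1/2),
          |u x - u y| ≤ C * μ ^ (-q) * ‖x - y‖ := by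
  have hLam : 0 < Lam := hlam.trans_le hlamLam
  set L := (262 * (n * Lam) + 3) / lam with hL_def
  have hL : 0 < L := by positivity
  have hlamL : lam * L = 262 * (n * Lam) + 3 := by rw [hL_def]; field_simp
  refine ⟨L + 33, by positivity, ?_⟩
  intro F hF κ q ϑ μ _ hq hϑ hμ ξ u f hu hf huc _ hsol hξ hϑC
  have hK : 1 ≤ μ ^ (-q) :=
    Real.one_le_rpow_of_pos_of_le_one_of_nonpos hμ.1 hμ.2.le (by linarith)
  have hKμ : μ ^ (q + 1) * μ ^ (-q) = μ := by
    rw [← Real.rpow_add hμ.1]; simp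
  set K := μ ^ (-q) with hK_def
  have hϑL : ϑ * (L * K + 33) ≤ μ := by
    rw [le_div_iff₀ (by positivity)] at hϑC
    have h1 := mul_le_mul_of_nonneg_right hϑC (by positivity : 0 ≤ K)
    rw [hKμ] at h1
    nlinarith [mul_nonneg hϑ.le (by linarith : 0 ≤ K - 1),
      mul_nonneg hϑ.le (by positivity : 0 ≤ L * K), hμ.1]
  have hLK : 262 * (n * Lam) + 2 * K < lam * (L * K) := by
    have hnLam : 0 ≤ n * Lam := by positivity
    rw [← mul_assoc lam, hlamL]
    nlinarith
  have key : ∀ x ∈ ball (0 : Euc n) (1 / 2), ∀ y ∈ ball (0 : Euc n) (1 / 2),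
      u x - u y ≤ (L + 33) * K * ‖x - y‖ := by
    intro x hx y hy
    have hd := norm_nonneg (x - y)
    have hKd : 33 * ‖x - y‖ ≤ 33 * K * ‖x - y‖ :=
      mul_le_mul_of_nonneg_right (by linarith) hd
    have hLd : 0 ≤ L * K * ‖x - y‖ := by positivity
    rcases le_or_gt ‖x - y‖ (1 / 4) with h | h
    · have h1 := hsol.sub_le_profile hlam hlamLam hF hq hϑ hμ.1 hu hf huc hξ
        (L := L * K) (by positivity) hLK hϑL hx x
        (mem_closedBall_self (by norm_num)) y
        (by rwa [mem_closedBall_iff_norm, norm_sub_rev])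
      rw [sub_self, norm_zero, norm_sub_rev y x] at h1
      have h2 : 0 ≤ L * K * (‖x - y‖ ^ 2 / 8) := by positivity
      nlinarith
    · have hx1 := abs_le.1 (hu x (ball_subset_ball (by norm_num) hx))
      have hy1 := abs_le.1 (hu y (ball_subset_ball (by norm_num) hy))
      linarith
  intro x hx y hy
  refine abs_le.2 ⟨?_, key x hx y hy⟩
  have := key y hy x hx
  rw [norm_sub_rev] at this
  linarith

end
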